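/- arXiv:2605.06210 — 3 statements merged into one kernel-verified Lean document; each statement's English description precedes it below -/
import Mathlib

section
/- Let d ≥ 1, let T : ℝ^d → ℝ^d be a measurable bijection with measurable inverse that preserves Lebesgue measure, let L be an invertible d × d real matrix, let μ₀ ∈ ℝ^d, and let q ≥ 0. Then the Lebesgue volume of the sub-level set { y ∈ ℝ^d : ‖L (T(y) − μ₀)‖₂² ≤ q } equals (q^{d/2} / |det L|) · Vol(B), where Vol(B) is the Lebesgue volume of the closed Euclidean unit ball in ℝ^d. -/
open MeasureTheory

/-- **Closed-form volume of the flow-based Mahalanobis sub-level set.** If `T` is a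
measurable bijection of `ℝ^d` (with measurable inverse) preserving Lebesgue measure,
`L` is an invertible `d × d` matrix, `μ₀ ∈ ℝ^d` and `q ≥ 0`, then the Lebesgue volume of
`{ y | ‖L (T y − μ₀)‖² ≤ q }` equals `(q^{d/2} / |det L|) · Vol(closed unit ball)`. -/
theorem volume_mahalanobis_sublevel
    (d : ℕ) (hd : 1 ≤ d)
    (T : EuclideanSpace ℝ (Fin d) ≃ᵐ EuclideanSpace ℝ (Fin d))
    (hT : MeasurePreserving T volume volume)
    (L : Matrix (Fin d) (Fin d) ℝ) (hL : L.det ≠ 0)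
    (μ₀ : EuclideanSpace ℝ (Fin d)) (q : ℝ) (hq : 0 ≤ q) :
    volume {y : EuclideanSpace ℝ (Fin d) |
        ‖Matrix.toEuclideanLin L (T y - μ₀)‖ ^ 2 ≤ q}
      = ENNReal.ofReal (q ^ ((d : ℝ) / 2) / |L.det|)
          * volume (Metric.closedBall (0 : EuclideanSpace ℝ (Fin d)) 1) := by
  have hdet : LinearMap.det (Matrix.toEuclideanLin L) = L.det :=
    LinearMap.det_toLpLin 2 L
  have hset : {y : EuclideanSpace ℝ (Fin d) | ‖Matrix.toEuclideanLin L (T y - μ₀)‖ ^ 2 ≤ q}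
      = T ⁻¹' ((fun z => z - μ₀) ⁻¹'
        (Matrix.toEuclideanLin L ⁻¹' Metric.closedBall 0 (Real.sqrt q))) := by
    ext y
    simp only [Set.mem_ofPred_eq, Set.mem_preimage, mem_closedBall_zero_iff]
    exact (Real.le_sqrt (norm_nonneg _) hq).symm
  have hpow : Real.sqrt q ^ d = q ^ ((d : ℝ) / 2) := by
    rw [Real.sqrt_eq_rpow, ← Real.rpow_natCast, ← Real.rpow_mul hq]
    congr 1
    ring
  rw [hset, hT.measure_preimage_equiv]
  simp only [sub_eq_add_neg]
  rw [measure_preimage_add_right,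
    Measure.addHaar_preimage_linearMap volume (by rw [hdet]; exact hL), hdet,
    Measure.addHaar_closedBall' volume _ (Real.sqrt_nonneg q), finrank_euclideanSpace_fin,
    hpow, ← mul_assoc, ← ENNReal.ofReal_mul (abs_nonneg _), abs_inv, div_eq_inv_mul _ |L.det|]
end

section
/- Let d ≥ 1 and let Ω ⊂ ℝ^d be the image of the closed Euclidean unit ball under a C^∞ diffeomorphism of ℝ^d (so Ω is a compact domain diffeomorphic to a closed ball). Then there exist a C^∞ diffeomorphism T : ℝ^d → ℝ^d that preserves Lebesgue measure, and a constant q > 0, such that Ω = { y ∈ ℝ^d : ‖T(y)‖₂² ≤ q }; moreover q = r² where r > 0 is the unique radius for which the closed ball of radius r centered at the origin has the same Lebesgue volume as Ω. -/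
open MeasureTheory

/-- A `C^∞` diffeomorphism of `ℝ^d`: a smooth bijection with smooth inverse. -/
def IsSmoothDiffeo {d : ℕ} (T : EuclideanSpace ℝ (Fin d) → EuclideanSpace ℝ (Fin d)) :
    Prop :=
  ContDiff ℝ (⊤ : ℕ∞) T ∧ ∃ S : EuclideanSpace ℝ (Fin d) → EuclideanSpace ℝ (Fin d),
    ContDiff ℝ (⊤ : ℕ∞) S ∧ Function.LeftInverse S T ∧ Function.RightInverse S T

open Set Filter Topology

/-- Euclidean space of dimension `d`. -/
abbrev EE (d : ℕ) := EuclideanSpace ℝ (Fin d)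

/-- Absolute Jacobian determinant. -/
noncomputable def jac {d : ℕ} (T : EE d → EE d) (x : EE d) : ℝ := |(fderiv ℝ T x).det|

theorem contDiff_param_nat {P : Type} [NormedAddCommGroup P] [NormedSpace ℝ P]
    [FiniteDimensional ℝ P] (a b : ℝ) (n : ℕ) :
    ∀ {F : Type} [NormedAddCommGroup F] [NormedSpace ℝ F] [CompleteSpace F]
      (f : P → ℝ → F), ContDiff ℝ n (fun p : P × ℝ => f p.1 p.2) →
      ContDiff ℝ n (fun x => ∫ s in a..b, f x s) := by
  have : ProperSpace P := FiniteDimensional.proper ℝ P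
  induction n with
  | zero =>
    intro F _ _ _ f hf
    simp only [Nat.cast_zero, contDiff_zero] at hf ⊢
    exact intervalIntegral.continuous_parametric_intervalIntegral_of_continuous' hf a b
  | succ n ih =>
    intro F _ _ _ f hf
    push_cast at hf ⊢
    have hd : Differentiable ℝ (fun p : P × ℝ => f p.1 p.2) := hf.differentiable (by simp)
    have hd' : ContDiff ℝ n (fderiv ℝ (fun p : P × ℝ => f p.1 p.2)) :=
      hf.fderiv_right le_rfl
    let f' : P → ℝ → (P →L[ℝ] F) := fun x s =>
      (fderiv ℝ (fun p : P × ℝ => f p.1 p.2) (x, s)).comp (ContinuousLinearMap.inl ℝ P ℝ)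
    have hf' : ContDiff ℝ n (fun p : P × ℝ => f' p.1 p.2) := by
      exact hd'.clm_comp contDiff_const
    have hfd : ∀ x s, HasFDerivAt (fun x => f x s) (f' x s) x := by
      intro x s
      have h1 : HasFDerivAt (fun x : P => (x, s)) (ContinuousLinearMap.inl ℝ P ℝ) x :=
        hasFDerivAt_prodMk_left x s
      exact HasFDerivAt.comp x (hd (x, s)).hasFDerivAt h1
    rw [contDiff_succ_iff_hasFDerivAt]
    refine ⟨fun x => ∫ s in a..b, f' x s, ih f' hf', fun x₀ => ?_⟩
    have hcf : Continuous (fun p : P × ℝ => f p.1 p.2) := hf.continuous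
    have hcf' : Continuous (fun p : P × ℝ => f' p.1 p.2) := hf'.continuous
    obtain ⟨C, hC⟩ := ((isCompact_closedBall x₀ 1).prod (isCompact_uIcc (a := a) (b := b))
      ).exists_bound_of_continuousOn hcf'.continuousOn
    refine (intervalIntegral.hasFDerivAt_integral_of_dominated_of_fderiv_le
      (s := Metric.closedBall x₀ 1) (bound := fun _ => C)
      (Metric.closedBall_mem_nhds x₀ one_pos) ?_ ?_ ?_ ?_ ?_ ?_)
    · refine Eventually.of_forall fun x => ?_
      exact (hcf.comp (Continuous.prodMk_right x)).aestronglyMeasurable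
    · exact (hcf.comp (Continuous.prodMk_right x₀)).intervalIntegrable _ _
    · exact (hcf'.comp (Continuous.prodMk_right x₀)).aestronglyMeasurable
    · refine Eventually.of_forall fun t ht x hx => ?_
      exact hC (x, t) ⟨hx, uIoc_subset_uIcc ht⟩
    · exact intervalIntegrable_const
    · exact Eventually.of_forall fun t _ x _ => hfd x t

theorem contDiff_param {P F : Type} [NormedAddCommGroup P] [NormedSpace ℝ P]
    [FiniteDimensional ℝ P] [NormedAddCommGroup F] [NormedSpace ℝ F] [CompleteSpace F]
    (a b : ℝ) (f : P → ℝ → F) (hf : ContDiff ℝ (⊤ : ℕ∞) (fun p : P × ℝ => f p.1 p.2)) :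
      ContDiff ℝ (⊤ : ℕ∞) (fun x => ∫ s in a..b, f x s) := by
  rw [contDiff_infty]
  intro n
  exact contDiff_param_nat a b n f (hf.of_le (by exact_mod_cast le_top))

theorem isSmoothDiffeo_of {d : ℕ} {T : EE d → EE d} (hT : ContDiff ℝ (⊤ : ℕ∞) T)
    (hb : Function.Bijective T) (hdet : ∀ x, (fderiv ℝ T x).det ≠ 0) : IsSmoothDiffeo T := by
  have hs : ∀ x, HasStrictFDerivAt T
      ((fderiv ℝ T x).toContinuousLinearEquivOfDetNeZero (hdet x) : EE d →L[ℝ] EE d) x := by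
    intro x
    have := (hT.contDiffAt (x := x)).hasStrictFDerivAt (by simp)
    rwa [ContinuousLinearMap.coe_toContinuousLinearEquivOfDetNeZero]
  have hopen : IsOpenMap T := isOpenMap_iff_nhds_le.2 fun x =>
    ((hs x).map_nhds_eq_of_equiv).ge
  let e := Equiv.ofBijective T hb
  let h : EE d ≃ₜ EE d := e.toHomeomorphOfContinuousOpen hT.continuous hopen
  refine ⟨hT, h.symm, ?_, h.symm_apply_apply, h.apply_symm_apply⟩
  exact h.contDiff_symm (f₀' := fun x => (fderiv ℝ T x).toContinuousLinearEquivOfDetNeZero (hdet x))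
    (fun x => (hs x).hasFDerivAt) hT

theorem IsSmoothDiffeo.bij {d : ℕ} {T : EE d → EE d} (hT : IsSmoothDiffeo T) :
    Function.Bijective T := by
  obtain ⟨-, S, -, h1, h2⟩ := hT
  exact ⟨h1.injective, h2.surjective⟩

theorem IsSmoothDiffeo.diff {d : ℕ} {T : EE d → EE d} (hT : IsSmoothDiffeo T) :
    Differentiable ℝ T := hT.1.differentiable (by simp)

theorem IsSmoothDiffeo.comp {d : ℕ} {T U : EE d → EE d} (hT : IsSmoothDiffeo T)
    (hU : IsSmoothDiffeo U) : IsSmoothDiffeo (T ∘ U) := by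
  obtain ⟨hT, S, hS, h1, h2⟩ := hT
  obtain ⟨hU, V, hV, h3, h4⟩ := hU
  exact ⟨hT.comp hU, V ∘ S, hV.comp hS, h1.comp h3, h2.comp h4⟩

theorem IsSmoothDiffeo.exists_inv {d : ℕ} {T : EE d → EE d} (hT : IsSmoothDiffeo T) :
    ∃ S : EE d → EE d, IsSmoothDiffeo S ∧ (∀ x, S (T x) = x) ∧ (∀ x, T (S x) = x) := by
  obtain ⟨hT, S, hS, h1, h2⟩ := hT
  exact ⟨S, ⟨hS, T, hT, h2, h1⟩, h1, h2⟩

theorem jac_comp {d : ℕ} {T U : EE d → EE d} (hT : Differentiable ℝ T)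
    (hU : Differentiable ℝ U) (x : EE d) : jac (T ∘ U) x = jac T (U x) * jac U x := by
  unfold jac
  rw [fderiv_comp x (hT _) (hU _), ← abs_mul]
  congr 1
  simp [ContinuousLinearMap.det]

theorem jac_id {d : ℕ} (x : EE d) : jac (fun x : EE d => x) x = 1 := by
  simp [jac, ContinuousLinearMap.det]

theorem IsSmoothDiffeo.jac_pos {d : ℕ} {T : EE d → EE d} (hT : IsSmoothDiffeo T) (x : EE d) :
    0 < jac T x := by
  obtain ⟨S, hS, h1, h2⟩ := hT.exists_inv
  have := jac_comp hS.diff hT.diff x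
  have h : S ∘ T = fun x => x := funext h1
  rw [h, jac_id] at this
  refine lt_of_le_of_ne (abs_nonneg _) ?_
  intro h0
  change 0 = jac T x at h0
  rw [← h0] at this
  simp at this

theorem contDiff_det {d : ℕ} {T : EE d → EE d} (hT : ContDiff ℝ (⊤ : ℕ∞) T) :
    ContDiff ℝ (⊤ : ℕ∞) (fun x => (fderiv ℝ T x).det) := by
  have h : ∀ x, (fderiv ℝ T x).det = (Matrix.of fun i j : Fin d =>
      (fderiv ℝ T x (EuclideanSpace.single j 1)) i).det := by
    intro x
    rw [ContinuousLinearMap.det, ← LinearMap.det_toMatrix (EuclideanSpace.basisFun (Fin d) ℝ).toBasis]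
    congr 1
  simp_rw [h, Matrix.det_apply]
  have hf : ContDiff ℝ (⊤ : ℕ∞) (fderiv ℝ T) := hT.fderiv_right (by simp)
  refine ContDiff.sum fun σ _ => ContDiff.const_smul _ (contDiff_prod fun i _ => ?_)
  have h1 : ContDiff ℝ (⊤ : ℕ∞) (fun x => fderiv ℝ T x (EuclideanSpace.single i 1)) :=
    hf.clm_apply contDiff_const
  exact (contDiff_euclidean.1 h1) _

theorem IsSmoothDiffeo.contDiff_jac {d : ℕ} {T : EE d → EE d} (hT : IsSmoothDiffeo T) :
    ContDiff ℝ (⊤ : ℕ∞) (jac T) := by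
  have := contDiff_det hT.1
  rw [contDiff_iff_contDiffAt]
  intro x
  exact this.contDiffAt.abs (abs_pos.1 (hT.jac_pos x))

theorem IsSmoothDiffeo.lintegral_image {d : ℕ} {T : EE d → EE d} (hT : IsSmoothDiffeo T)
    {s : Set (EE d)} (hs : MeasurableSet s) (g : EE d → ENNReal) :
    ∫⁻ x in T '' s, g x = ∫⁻ x in s, ENNReal.ofReal (jac T x) * g (T x) :=
  lintegral_image_eq_lintegral_abs_det_fderiv_mul volume hs
    (fun x _ => (hT.diff x).hasFDerivAt.hasFDerivWithinAt) hT.bij.1.injOn g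

theorem IsSmoothDiffeo.volume_image {d : ℕ} {T : EE d → EE d} (hT : IsSmoothDiffeo T)
    {s : Set (EE d)} (hs : MeasurableSet s) :
    volume (T '' s) = ∫⁻ x in s, ENNReal.ofReal (jac T x) := 
  (lintegral_abs_det_fderiv_eq_addHaar_image volume hs
    (fun x _ => (hT.diff x).hasFDerivAt.hasFDerivWithinAt) hT.bij.1.injOn).symm

theorem IsSmoothDiffeo.measurePreserving {d : ℕ} {T : EE d → EE d} (hT : IsSmoothDiffeo T)
    (hj : ∀ x, jac T x = 1) : MeasurePreserving T volume volume := by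
  refine ⟨hT.1.continuous.measurable, ?_⟩
  ext s hs
  rw [Measure.map_apply hT.1.continuous.measurable hs]
  have := hT.volume_image (hT.1.continuous.measurable hs)
  rw [image_preimage_eq s hT.bij.2] at this
  simp only [hj, ENNReal.ofReal_one, lintegral_const, Measure.restrict_apply MeasurableSet.univ,
    univ_inter, one_mul] at this
  exact this.symm

theorem det_rank_one {d : ℕ} (u : ℝ) (hu : u ≠ 0) (l : EE d →L[ℝ] ℝ) (v : EE d) :
    (u • ContinuousLinearMap.id ℝ (EE d) + l.smulRight v).det = u ^ d * (1 + u⁻¹ * l v) := by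
  have : ((u • ContinuousLinearMap.id ℝ (EE d) + l.smulRight v : EE d →L[ℝ] EE d) : EE d →ₗ[ℝ] EE d)
      = u • LinearMap.transvection (u⁻¹ • (l : EE d →ₗ[ℝ] ℝ)) v := by
    ext x : 1
    simp [LinearMap.transvection, smul_add, smul_smul, hu]
  rw [ContinuousLinearMap.det, this, LinearMap.det_smul, LinearMap.transvection.det]
  simp


/-- Diffeomorphisms whose Jacobian is bounded above and away from zero. -/
def BD {d : ℕ} (T : EE d → EE d) : Prop :=
  IsSmoothDiffeo T ∧ ∃ c C : ℝ, 0 < c ∧ ∀ x, c ≤ jac T x ∧ jac T x ≤ C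

theorem BD.comp {d : ℕ} {T U : EE d → EE d} (hT : BD T) (hU : BD U) : BD (T ∘ U) := by
  obtain ⟨hT, c, C, hc, h⟩ := hT
  obtain ⟨hU, c', C', hc', h'⟩ := hU
  refine ⟨hT.comp hU, c * c', C * C', mul_pos hc hc', fun x => ?_⟩
  rw [jac_comp hT.diff hU.diff]
  have h1 := h (U x)
  have h2 := h' x
  exact ⟨mul_le_mul h1.1 h2.1 hc'.le (hc.le.trans h1.1),
    mul_le_mul h1.2 h2.2 (hc'.le.trans h2.1) ((hc.le.trans h1.1).trans h1.2)⟩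

theorem BD.inv {d : ℕ} {T S : EE d → EE d} (hT : BD T) (hS : IsSmoothDiffeo S)
    (hTS : ∀ x, T (S x) = x) : BD S := by
  obtain ⟨hT, c, C, hc, h⟩ := hT
  have hC : 0 < C := hc.trans_le ((h 0).1.trans (h 0).2)
  refine ⟨hS, C⁻¹, c⁻¹, inv_pos.2 hC, fun x => ?_⟩
  have h1 := jac_comp hT.diff hS.diff x
  rw [show T ∘ S = fun x => x from funext hTS, jac_id] at h1
  have hp := hT.jac_pos (S x)
  have : jac S x = (jac T (S x))⁻¹ := by field_simp; linarith
  rw [this]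
  exact ⟨inv_anti₀ hp (h _).2, inv_anti₀ hc (h _).1⟩

theorem bounds_of_compact {X : Type*} [TopologicalSpace X] (f : X → ℝ) (hf : Continuous f) (hpos : ∀ x, 0 < f x)
    (K : Set X) (hK : IsCompact K) (h1 : ∀ x ∉ K, f x = 1) :
    ∃ c C : ℝ, 0 < c ∧ ∀ x, c ≤ f x ∧ f x ≤ C := by
  rcases K.eq_empty_or_nonempty with rfl | hne
  · exact ⟨1, 1, one_pos, fun x => by simp [h1 x]⟩
  obtain ⟨a, -, ha⟩ := hK.exists_isMinOn hne hf.continuousOn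
  obtain ⟨b, -, hb⟩ := hK.exists_isMaxOn hne hf.continuousOn
  refine ⟨min (f a) 1, max (f b) 1, lt_min (hpos a) one_pos, fun x => ?_⟩
  by_cases hx : x ∈ K
  · exact ⟨(min_le_left _ _).trans (ha hx), (hb hx).trans (le_max_left _ _)⟩
  · rw [h1 x hx]; exact ⟨min_le_right _ _, le_max_right _ _⟩

theorem perturb {d : ℕ} {J : EE d → EE d} (hJ : ContDiff ℝ (⊤ : ℕ∞) J)
    (K : Set (EE d)) (hK : IsCompact K) (h0 : ∀ x ∉ K, fderiv ℝ J x = 0)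
    (hb : ∀ x, ‖fderiv ℝ J x‖ ≤ 1 / 2) : BD (fun x => x + J x) := by
  have hJd : Differentiable ℝ J := hJ.differentiable (by simp)
  have hlip : LipschitzWith (1 / 2) J :=
    lipschitzWith_of_nnnorm_fderiv_le hJd (fun x => by
      have := hb x
      rw [← NNReal.coe_le_coe]; simpa using this)
  have hC : ContDiff ℝ (⊤ : ℕ∞) (fun x => x + J x) := contDiff_id.add hJ
  have hfd : ∀ x, fderiv ℝ (fun x => x + J x) x = ContinuousLinearMap.id ℝ _ + fderiv ℝ J x := by
    intro x
    exact ((hasFDerivAt_id x).add (hJd x).hasFDerivAt).fderiv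
  have hbij : Function.Bijective (fun x => x + J x) := by
    constructor
    · intro x y hxy
      simp only at hxy
      have h1 : x - y = J y - J x := by
        rw [sub_eq_sub_iff_add_eq_add, hxy, add_comm]
      have h2 := hlip.dist_le_mul y x
      rw [dist_eq_norm, dist_eq_norm, ← h1, norm_sub_rev y x] at h2
      have h3 : ‖x - y‖ = 0 := by
        have := norm_nonneg (x - y)
        norm_num at h2
        linarith
      exact sub_eq_zero.1 (norm_eq_zero.1 h3)
    · intro y
      have hcon : ContractingWith (1 / 2) (fun x => y - J x) := by
        refine ⟨by rw [← NNReal.coe_lt_coe]; norm_num, ?_⟩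
        refine LipschitzWith.of_dist_le_mul fun a b => ?_
        rw [dist_sub_left]
        exact hlip.dist_le_mul a b
      refine ⟨hcon.fixedPoint _, ?_⟩
      have := hcon.fixedPoint_isFixedPt
      have h2 : y - J (hcon.fixedPoint _) = hcon.fixedPoint _ := this
      exact (sub_eq_iff_eq_add.1 h2).symm
  have hdet : ∀ x, (fderiv ℝ (fun x => x + J x) x).det ≠ 0 := by
    intro x hx
    rw [hfd, ContinuousLinearMap.det] at hx
    obtain ⟨v, hv, hv0⟩ := (Submodule.ne_bot_iff _).1 (LinearMap.bot_lt_ker_of_det_eq_zero hx).ne'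
    have h1 : v + fderiv ℝ J x v = 0 := by simpa using hv
    have h2 : ‖v‖ ≤ 1 / 2 * ‖v‖ := by
      calc ‖v‖ = ‖fderiv ℝ J x v‖ := by rw [eq_neg_of_add_eq_zero_left h1, norm_neg]
                                        simp [← eq_neg_of_add_eq_zero_left h1]
        _ ≤ ‖fderiv ℝ J x‖ * ‖v‖ := ContinuousLinearMap.le_opNorm _ _
        _ ≤ _ := by gcongr; exact hb x
    have := norm_pos_iff.2 hv0
    linarith
  have hD := isSmoothDiffeo_of hC hbij hdet
  refine ⟨hD, bounds_of_compact _ hD.contDiff_jac.continuous hD.jac_pos K hK fun x hx => ?_⟩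
  simp [jac, hfd, h0 x hx, ContinuousLinearMap.det]

theorem diffeo_affine {d : ℕ} (t : ℝ) (ht : t ≠ 0) (b : EE d) :
    IsSmoothDiffeo (fun x : EE d => t • x + b) := by
  refine ⟨by fun_prop, fun x => t⁻¹ • (x - b), by fun_prop, fun x => ?_, fun x => ?_⟩
  · simp [smul_smul, ht]
  · simp [smul_smul, ht]

theorem exists_bounded {d : ℕ} {Φ : EE d → EE d} (hΦ : IsSmoothDiffeo Φ) :
    ∃ Ψ, BD Ψ ∧ ∀ x ∈ Metric.closedBall (0 : EE d) 1, Ψ x = Φ x := by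
  have hΦd := hΦ.diff
  have hΦ' : ContDiff ℝ (⊤ : ℕ∞) (fderiv ℝ Φ) := hΦ.1.fderiv_right (by simp)
  let G : ℝ → EE d → EE d := fun t x => ∫ s in (0:ℝ)..1, fderiv ℝ Φ ((s * t) • x) x
  have hG : ContDiff ℝ (⊤ : ℕ∞) (fun p : ℝ × EE d => G p.1 p.2) := by
    refine contDiff_param 0 1 (fun (p : ℝ × EE d) s => fderiv ℝ Φ ((s * p.1) • p.2) p.2) ?_
    refine ContDiff.clm_apply (hΦ'.comp ?_) ?_ <;> fun_prop
  have hG0 : ∀ x, G 0 x = fderiv ℝ Φ 0 x := by intro x; simp [G]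
  have hGt : ∀ t x, t • G t x = Φ (t • x) - Φ 0 := by
    intro t x
    have h1 : ∀ s ∈ uIcc (0:ℝ) 1, HasDerivAt (fun s : ℝ => Φ ((s * t) • x))
        (t • fderiv ℝ Φ ((s * t) • x) x) s := by
      intro s _
      have h2 : HasDerivAt (fun s : ℝ => (s * t) • x) (t • x) s := by
        simpa using ((hasDerivAt_id s).mul_const t).smul_const x
      have := (hΦd ((s * t) • x)).hasFDerivAt.comp_hasDerivAt s h2
      rw [map_smul] at this
      exact this
    have hcont : Continuous (fun s : ℝ => fderiv ℝ Φ ((s * t) • x) x) := by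
      refine Continuous.clm_apply (hΦ'.continuous.comp ?_) ?_ <;> fun_prop
    have h2 := intervalIntegral.integral_eq_sub_of_hasDerivAt h1
      ((hcont.const_smul t).intervalIntegrable _ _)
    simp only [intervalIntegral.integral_smul] at h2
    simpa [G] using h2
  have hGdiff : ∀ t, IsSmoothDiffeo (G t) := by
    intro t
    by_cases ht : t = 0
    · subst ht
      have h1 : G 0 = fun x => fderiv ℝ Φ 0 x := funext hG0
      have hdet : (fderiv ℝ Φ 0).det ≠ 0 := abs_pos.1 (hΦ.jac_pos 0)
      let e := (fderiv ℝ Φ 0).toContinuousLinearEquivOfDetNeZero hdet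
      have he : ∀ x, e x = fderiv ℝ Φ 0 x := fun x => rfl
      rw [h1]
      refine ⟨by fun_prop, e.symm, e.symm.contDiff, fun x => ?_, fun x => ?_⟩
      · exact e.symm_apply_apply x
      · exact e.apply_symm_apply x
    · have h1 : G t = (fun y => t⁻¹ • y + -(t⁻¹ • Φ 0)) ∘ Φ ∘ (fun x => t • x + 0) := by
        funext x
        have := hGt t x
        have h2 : G t x = t⁻¹ • (Φ (t • x) - Φ 0) := by
          rw [← this, smul_smul, inv_mul_cancel₀ ht, one_smul]
        rw [h2, smul_sub]
        simp [sub_eq_add_neg]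
      rw [h1]
      exact (diffeo_affine _ (inv_ne_zero ht) _).comp (hΦ.comp (diffeo_affine t ht 0))
  let P : ℝ → Prop := fun t => ∃ Ψ, BD Ψ ∧ ∀ x ∈ Metric.closedBall (0 : EE d) 1, Ψ x = G t x
  have hloc : ∀ t0, ∀ᶠ t in 𝓝 t0, ∃ H : EE d → EE d, BD H ∧
      ∀ x ∈ Metric.closedBall (0 : EE d) 1, H (G t0 x) = G t x := by
    intro t0
    obtain ⟨S, hS, hS1, hS2⟩ := (hGdiff t0).exists_inv
    have hKc : IsCompact (G t0 '' Metric.closedBall (0 : EE d) 1) :=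
      (isCompact_closedBall _ _).image (hGdiff t0).1.continuous
    obtain ⟨R, hR, hKR⟩ := hKc.isBounded.subset_closedBall_lt 0 0
    let η : ContDiffBump (0 : EE d) := ⟨R, R + 1, hR, by linarith⟩
    let J : ℝ → EE d → EE d := fun t x => η x • (G t (S x) - x)
    have hJ : ContDiff ℝ (⊤ : ℕ∞) (fun p : ℝ × EE d => J p.1 p.2) := by
      refine ContDiff.smul (η.contDiff.comp contDiff_snd) (ContDiff.sub ?_ contDiff_snd)
      exact hG.comp (contDiff_fst.prodMk (hS.1.comp contDiff_snd))
    have hJt : ∀ t, ContDiff ℝ (⊤ : ℕ∞) (J t) := fun t =>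
      hJ.comp (contDiff_const.prodMk contDiff_id)
    have hfd : ∀ t x, fderiv ℝ (J t) x =
        (fderiv ℝ (fun p : ℝ × EE d => J p.1 p.2) (t, x)).comp (ContinuousLinearMap.inr ℝ ℝ (EE d)) := by
      intro t x
      have h1 : HasFDerivAt (fun x : EE d => (t, x)) (ContinuousLinearMap.inr ℝ ℝ (EE d)) x :=
        hasFDerivAt_prodMk_right t x
      exact (HasFDerivAt.comp x ((hJ.differentiable (by simp)) (t, x)).hasFDerivAt h1).fderiv
    have hcont : Continuous (fun p : ℝ × EE d => ‖fderiv ℝ (J p.1) p.2‖) := by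
      simp_rw [hfd]
      have : Continuous (fderiv ℝ (fun p : ℝ × EE d => J p.1 p.2)) :=
        hJ.continuous_fderiv (by simp)
      exact (this.clm_comp continuous_const).norm
    have hz : ∀ x, fderiv ℝ (J t0) x = 0 := by
      intro x
      have : J t0 = fun _ => 0 := by
        funext x; simp [J, hS2]
      rw [this]; simp
    have hout : ∀ t, ∀ x ∉ Metric.closedBall (0 : EE d) (R + 1), fderiv ℝ (J t) x = 0 := by
      intro t x hx
      have : J t =ᶠ[𝓝 x] fun _ => 0 := by
        filter_upwards [Metric.isClosed_closedBall.isOpen_compl.mem_nhds hx] with y hy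
        have : η y = 0 := η.zero_of_le_dist (by
          have : ¬ dist y 0 ≤ R + 1 := hy
          exact (not_le.1 this).le)
        simp [J, this]
      rw [this.fderiv_eq]; simp
    have hev : ∀ᶠ t in 𝓝 t0, ∀ x ∈ Metric.closedBall (0 : EE d) (R + 1), ‖fderiv ℝ (J t) x‖ < 1 / 2 := by
      refine (isCompact_closedBall (0 : EE d) (R + 1)).eventually_forall_of_forall_eventually fun x _ => ?_
      have := hcont.continuousAt (x := (t0, x))
      exact this.eventually_lt_const (by simp [hz])
    filter_upwards [hev] with t ht
    refine ⟨fun x => x + J t x, perturb (hJt t) _ (isCompact_closedBall (0 : EE d) (R + 1)) (hout t) ?_, ?_⟩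
    · intro x
      by_cases hx : x ∈ Metric.closedBall (0 : EE d) (R + 1)
      · exact (ht x hx).le
      · rw [hout t x hx]; norm_num
    · intro x hx
      have h1 : η (G t0 x) = 1 := η.one_of_mem_closedBall (hKR ⟨x, hx, rfl⟩)
      simp [J, h1, hS1]
  have hlc : IsLocallyConstant P := by
    rw [IsLocallyConstant.iff_eventually_eq]
    intro t0
    filter_upwards [hloc t0] with t ⟨H, hH, hHe⟩
    refine propext ⟨?_, ?_⟩
    · rintro ⟨Ψ, hΨ, he⟩
      obtain ⟨S, hS, h1, h2⟩ := hH.1.exists_inv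
      refine ⟨S ∘ Ψ, (hH.inv hS h2).comp hΨ, fun x hx => ?_⟩
      simp [he x hx, ← hHe x hx, h1]
    · rintro ⟨Ψ, hΨ, he⟩
      exact ⟨H ∘ Ψ, hH.comp hΨ, fun x hx => by simp [he x hx, hHe x hx]⟩
  have hP0 : P 0 := by
    refine ⟨G 0, ⟨hGdiff 0, jac (G 0) 0, jac (G 0) 0, (hGdiff 0).jac_pos 0, fun x => ?_⟩, fun _ _ => rfl⟩
    have : jac (G 0) x = jac (G 0) 0 := by
      rw [show G 0 = fun x => fderiv ℝ Φ 0 x from funext hG0]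
      simp [jac]
    rw [this]; simp
  have hP1 : P 1 := by
    have := hlc.apply_eq_of_preconnectedSpace 0 1
    rwa [← this]
  obtain ⟨Ψ, hΨ, he⟩ := hP1
  have hb : BD (fun x : EE d => x + Φ 0) := by
    have := perturb (J := fun _ : EE d => Φ 0) contDiff_const ∅ isCompact_empty (by simp) (by simp)
    exact this
  refine ⟨_, hb.comp hΨ, fun x hx => ?_⟩
  have := hGt 1 x
  simp only [one_smul] at this
  simp [he x hx, this]


theorem fderiv_radial {d : ℕ} {h : EE d → ℝ} {x : EE d} (hh : DifferentiableAt ℝ h x) :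
    HasDerivAt (fun t : ℝ => h (t • x)) (fderiv ℝ h x x) 1 := by
  have h2 : HasDerivAt (fun s : ℝ => s • x) x 1 := by
    simpa using (hasDerivAt_id (1:ℝ)).smul_const x
  have h3 : HasFDerivAt h (fderiv ℝ h x) ((1:ℝ) • x) := by
    rw [one_smul]; exact hh.hasFDerivAt
  exact h3.comp_hasDerivAt (1:ℝ) h2

theorem radial_deriv {d : ℕ} (hd : 1 ≤ d) {h : EE d → ℝ} (hh : Differentiable ℝ h) (x : EE d)
    (t : ℝ) : HasDerivAt (fun t : ℝ => t ^ d * h (t • x))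
      (d * t ^ (d - 1) * (h (t • x) + 1 / d * fderiv ℝ h (t • x) (t • x))) t := by
  have h2 : HasDerivAt (fun s : ℝ => s • x) x t := by
    simpa using (hasDerivAt_id t).smul_const x
  have h3 := ((hh (t • x)).hasFDerivAt).comp_hasDerivAt t h2
  have h4 := (hasDerivAt_pow d t).mul h3
  refine h4.congr_deriv ?_
  have hd0 : (d : ℝ) ≠ 0 := by positivity
  have : t ^ d = t ^ (d - 1) * t := by rw [← pow_succ]; congr 1; omega
  rw [this, map_smul, smul_eq_mul]
  simp only [Function.comp_apply]
  field_simp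

theorem radial_mono {d : ℕ} (hd : 1 ≤ d) {h : EE d → ℝ} (hh : Differentiable ℝ h) {c : ℝ}
    (hc : ∀ x, c ≤ h x + 1 / d * fderiv ℝ h x x) (x : EE d) :
    MonotoneOn (fun t : ℝ => t ^ d * h (t • x) - c * t ^ d) (Ici 0) := by
  have hder : ∀ t : ℝ, HasDerivAt (fun t : ℝ => t ^ d * h (t • x) - c * t ^ d)
      (d * t ^ (d - 1) * (h (t • x) + 1 / d * fderiv ℝ h (t • x) (t • x)) -
        c * (d * t ^ (d - 1))) t := fun t =>
    (radial_deriv hd hh x t).sub ((hasDerivAt_pow d t).const_mul c)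
  refine monotoneOn_of_deriv_nonneg (convex_Ici 0) ?_ ?_ ?_
  · exact fun t _ => (hder t).continuousAt.continuousWithinAt
  · exact fun t _ => (hder t).differentiableAt.differentiableWithinAt
  · intro t ht
    rw [interior_Ici] at ht
    rw [(hder t).deriv]
    have h1 := hc (t • x)
    have h2 : 0 ≤ d * t ^ (d - 1) := by have : 0 < t := ht; positivity
    nlinarith [mul_le_mul_of_nonneg_left h1 h2]

theorem radial_strictMono {d : ℕ} (hd : 1 ≤ d) {h : EE d → ℝ} (hh : Differentiable ℝ h) {c : ℝ}
    (hc0 : 0 < c) (hc : ∀ x, c ≤ h x + 1 / d * fderiv ℝ h x x) (x : EE d) :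
    StrictMonoOn (fun t : ℝ => t ^ d * h (t • x)) (Ici 0) := by
  intro s hs t ht hst
  have h1 := radial_mono hd hh hc x hs ht hst.le
  have h2 : s ^ d < t ^ d := pow_lt_pow_left₀ hst hs (by omega)
  simp only at h1 ⊢
  nlinarith

theorem radial_lower {d : ℕ} (hd : 1 ≤ d) {h : EE d → ℝ} (hh : Differentiable ℝ h) {c : ℝ}
    (hc : ∀ x, c ≤ h x + 1 / d * fderiv ℝ h x x) (x : EE d) (t : ℝ) (ht : 0 ≤ t) :
    c * t ^ d ≤ t ^ d * h (t • x) := by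
  have h1 := radial_mono hd hh hc x self_mem_Ici ht ht
  have : (0:ℝ) ^ d = 0 := zero_pow (by omega)
  simp only [this] at h1
  linarith

theorem radial {d : ℕ} (hd : 1 ≤ d) {h : EE d → ℝ} (hs : ContDiff ℝ (⊤ : ℕ∞) h) {c : ℝ}
    (hc0 : 0 < c) (hc : ∀ x, c ≤ h x + 1 / d * fderiv ℝ h x x) :
    IsSmoothDiffeo (fun x => (h x ^ (1 / (d : ℝ))) • x) ∧
    (∀ x, jac (fun x => (h x ^ (1 / (d : ℝ))) • x) x = h x + 1 / d * fderiv ℝ h x x) ∧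
    (∀ x, ‖(h x ^ (1 / (d : ℝ))) • x‖ ^ d = ‖x‖ ^ d * h x) := by
  have hh : Differentiable ℝ h := hs.differentiable (by simp)
  have hpos : ∀ x, 0 < h x := by
    intro x
    have := radial_lower hd hh hc x 1 zero_le_one
    simp at this
    linarith
  have hd0 : (d : ℝ) ≠ 0 := by positivity
  set u : EE d → ℝ := fun x => h x ^ (1 / (d : ℝ)) with hu
  have hupos : ∀ x, 0 < u x := fun x => Real.rpow_pos_of_pos (hpos x) _
  have hud : ∀ x, u x ^ d = h x := by
    intro x
    rw [hu]
    simp only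
    rw [← Real.rpow_natCast, ← Real.rpow_mul (hpos x).le, one_div, inv_mul_cancel₀ hd0, Real.rpow_one]
  have hus : ContDiff ℝ (⊤ : ℕ∞) u := hs.rpow_const_of_ne fun x => (hpos x).ne'
  have hψs : ContDiff ℝ (⊤ : ℕ∞) (fun x => u x • x) := hus.smul contDiff_id
  have hnorm : ∀ x, ‖u x • x‖ ^ d = ‖x‖ ^ d * h x := by
    intro x
    rw [norm_smul, mul_pow, Real.norm_of_nonneg (hupos x).le, hud, mul_comm]
  have hdet : ∀ x, (fderiv ℝ (fun x => u x • x) x).det = h x + 1 / d * fderiv ℝ h x x := by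
    intro x
    have h1 : HasFDerivAt u ((1 / (d : ℝ) * h x ^ (1 / (d : ℝ) - 1)) • fderiv ℝ h x) x :=
      (hh x).hasFDerivAt.rpow_const (Or.inl (hpos x).ne')
    have h2 := (h1.smul (hasFDerivAt_id x)).fderiv
    have h3 : fderiv ℝ (fun x => u x • x) x = u x • ContinuousLinearMap.id ℝ (EE d) +
      ((1 / (d : ℝ) * h x ^ (1 / (d : ℝ) - 1)) • fderiv ℝ h x).smulRight x := h2
    rw [h3, det_rank_one _ (hupos x).ne', hud]
    have h4 : h x ^ (1 / (d : ℝ) - 1) = u x / h x := by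
      rw [Real.rpow_sub (hpos x), Real.rpow_one]
    have := (hpos x).ne'
    have := (hupos x).ne'
    simp only [smul_apply, smul_eq_mul, h4]
    field_simp
  have hbij : Function.Bijective (fun x => u x • x) := by
    constructor
    · intro x y hxy
      simp only at hxy
      have hyx : y = ((u y)⁻¹ * u x) • x := by
        rw [← smul_smul, hxy, smul_smul, inv_mul_cancel₀ (hupos y).ne', one_smul]
      set l := (u y)⁻¹ * u x with hl
      have hlpos : 0 < l := mul_pos (inv_pos.2 (hupos y)) (hupos x)
      by_cases hx0 : x = 0
      · rw [hyx, hx0, smul_zero]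
      have h1 := hnorm x
      rw [hxy, hnorm y, hyx, norm_smul, mul_pow, Real.norm_of_nonneg hlpos.le] at h1
      have hxn : ‖x‖ ^ d ≠ 0 := pow_ne_zero _ (norm_ne_zero_iff.2 hx0)
      have h2 : l ^ d * h (l • x) = 1 ^ d * h ((1:ℝ) • x) := by
        rw [one_pow, one_mul, one_smul]
        apply mul_left_cancel₀ hxn
        rw [← h1]; ring
      have h3 := (radial_strictMono hd hh hc0 hc x).injOn (show l ∈ Ici 0 from hlpos.le)
        (mem_Ici.2 zero_le_one) h2
      rw [hyx, h3, one_smul]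
    · intro y
      have hcont : Continuous (fun t : ℝ => t ^ d * h (t • y)) :=
        continuous_iff_continuousAt.2 fun t => (radial_deriv hd hh y t).continuousAt
      obtain ⟨N, hN⟩ : ∃ N : ℝ, 1 ≤ N ∧ 1 ≤ c * N := by
        refine ⟨max 1 c⁻¹, le_max_left _ _, ?_⟩
        calc 1 = c * c⁻¹ := by field_simp
          _ ≤ _ := by gcongr; exact le_max_right _ _
      have hN1 : 1 ≤ N ^ d * h (N • y) := by
        refine le_trans ?_ (radial_lower hd hh hc y N (by linarith))
        refine hN.2.trans ?_
        gcongr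
        exact le_self_pow₀ hN.1 (by omega)
      obtain ⟨t, ht, ht1⟩ := intermediate_value_Icc (show (0:ℝ) ≤ N by linarith) hcont.continuousOn
        (show (1:ℝ) ∈ Icc _ _ from ⟨by simp [zero_pow (show d ≠ 0 by omega)], hN1⟩)
      refine ⟨t • y, ?_⟩
      simp only at ht1 ⊢
      rw [smul_smul]
      have h1 : (u (t • y) * t) ^ d = 1 := by rw [mul_pow, hud, mul_comm, ht1]
      have h2 : u (t • y) * t = 1 := 
        (pow_eq_one_iff_of_nonneg (mul_nonneg (hupos _).le ht.1) (by omega)).1 h1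
      rw [h2, one_smul]
  refine ⟨isSmoothDiffeo_of hψs hbij fun x => ?_, fun x => ?_, hnorm⟩
  · rw [hdet]; exact (hc0.trans_le (hc x)).ne'
  · rw [jac, hdet, abs_of_pos (hc0.trans_le (hc x))]

theorem radial_ball {d : ℕ} (hd : 1 ≤ d) {h : EE d → ℝ} (hh : Differentiable ℝ h) {c : ℝ}
    (hc0 : 0 < c) (hc : ∀ x, c ≤ h x + 1 / d * fderiv ℝ h x x) (a : ℝ) (ha : 0 < a)
    (r : ℝ) (hr : 0 ≤ r) (hsph : ∀ x, ‖x‖ = a → a ^ d * h x = r ^ d)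
    (ψ : EE d → EE d) (hψ : ∀ x, ‖ψ x‖ ^ d = ‖x‖ ^ d * h x) (x : EE d) :
    ‖ψ x‖ ≤ r ↔ ‖x‖ ≤ a := by
  rw [← pow_le_pow_iff_left₀ (norm_nonneg _) hr (show d ≠ 0 by omega), hψ]
  by_cases hx : x = 0
  · have : (0:ℝ) ^ d = 0 := zero_pow (by omega)
    simp [hx, this, ha.le, pow_nonneg hr]
  have hxn : 0 < ‖x‖ := norm_pos_iff.2 hx
  set e := ‖x‖⁻¹ • x with he
  have hen : ‖e‖ = 1 := by rw [he, norm_smul]; simp [hxn.ne']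
  have hxe : x = ‖x‖ • e := by rw [he, smul_smul, mul_inv_cancel₀ hxn.ne', one_smul]
  have h1 := (radial_strictMono hd hh hc0 hc e).le_iff_le (show ‖x‖ ∈ Ici 0 from hxn.le)
    (show a ∈ Ici 0 from ha.le)
  rw [← hxe, hsph (a • e) (by rw [norm_smul, hen, Real.norm_of_nonneg ha.le, mul_one])] at h1
  exact h1


/-- The radial squeezing map. -/
theorem exists_kappa {d : ℕ} (hd : 1 ≤ d) {a b : ℝ} (ha : 0 < a) (ha1 : a ≤ 1) (hb0 : 0 ≤ b) (hb : b < 1) :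
    ∃ κ : EE d → EE d, IsSmoothDiffeo κ ∧ (∃ c > 0, ∀ x, c ≤ jac κ x) ∧
      (∀ x, ‖κ x‖ ≤ 1 ↔ ‖x‖ ≤ 1) ∧ (∀ x, ‖κ x‖ ≤ b → ‖x‖ ≤ a) := by
  have hd0 : (d : ℝ) ≠ 0 := by positivity
  have hdp : 0 < (d : ℝ) := by positivity
  obtain ⟨A, hA1, hA⟩ : ∃ A : ℝ, 1 ≤ A ∧ b ^ 2 * (1 + A * a ^ 2) ≤ a ^ 2 * (A + a ^ 2) := by
    have hb2 : 0 < 1 - b ^ 2 := by nlinarith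
    have hp : 0 < a ^ 2 * (1 - b ^ 2) := by positivity
    refine ⟨max 1 (a ^ 2 * (1 - b ^ 2))⁻¹, le_max_left _ _, ?_⟩
    have h1 : 1 ≤ (a ^ 2 * (1 - b ^ 2)) * max 1 (a ^ 2 * (1 - b ^ 2))⁻¹ := by
      calc 1 = (a ^ 2 * (1 - b ^ 2)) * (a ^ 2 * (1 - b ^ 2))⁻¹ := by field_simp
        _ ≤ _ := by gcongr; exact le_max_right _ _
    nlinarith [sq_nonneg (a ^ 2)]
  have hApos : 0 < A := by linarith
  let q : EE d → ℝ := fun x => (A + ‖x‖ ^ 2) / (1 + A * ‖x‖ ^ 2)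
  have hden : ∀ x : EE d, 0 < 1 + A * ‖x‖ ^ 2 := fun x => by positivity
  have hqpos : ∀ x, 0 < q x := fun x => by positivity
  have hqs : ContDiff ℝ (⊤ : ℕ∞) q := by
    refine ContDiff.div ?_ ?_ fun x => (hden x).ne'
    · exact contDiff_const.add (contDiff_norm_sq ℝ)
    · exact contDiff_const.add (contDiff_const.mul (contDiff_norm_sq ℝ))
  let h : EE d → ℝ := fun x => q x ^ ((d : ℝ) / 2)
  have hs : ContDiff ℝ (⊤ : ℕ∞) h := hqs.rpow_const_of_ne fun x => (hqpos x).ne'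
  have hqd : ∀ x, fderiv ℝ q x x = 2 * ‖x‖ ^ 2 * (1 - A ^ 2) / (1 + A * ‖x‖ ^ 2) ^ 2 := by
    intro x
    have h1 := fderiv_radial (hqs.differentiable (by simp) x)
    have hn : ∀ t : ℝ, ‖t • x‖ ^ 2 = t ^ 2 * ‖x‖ ^ 2 := by
      intro t; rw [norm_smul, mul_pow, Real.norm_eq_abs, sq_abs]
    simp only [q, hn] at h1
    have h2 : HasDerivAt (fun t : ℝ => t ^ 2 * ‖x‖ ^ 2) (2 * ‖x‖ ^ 2) 1 := by
      simpa using (hasDerivAt_pow 2 (1:ℝ)).mul_const (‖x‖ ^ 2)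
    have h3 := (h2.const_add A).div ((h2.const_mul A).const_add 1) (by simpa using (hden x).ne')
    rw [h1.unique h3]
    have := (hden x).ne'
    simp only [one_pow, one_mul]
    congr 1
    ring
  have hL : ∀ x, h x + 1 / d * fderiv ℝ h x x = h x * ((A + 2 * ‖x‖ ^ 2 + A * (‖x‖ ^ 2) ^ 2) /
      ((1 + A * ‖x‖ ^ 2) * (A + ‖x‖ ^ 2))) := by
    intro x
    have h1 : HasFDerivAt h (((d : ℝ) / 2 * q x ^ ((d : ℝ) / 2 - 1)) • fderiv ℝ q x) x :=
      (hqs.differentiable (by simp) x).hasFDerivAt.rpow_const (Or.inl (hqpos x).ne')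
    have h4 : q x ^ ((d : ℝ) / 2 - 1) = h x / q x := by
      rw [Real.rpow_sub (hqpos x), Real.rpow_one]
    rw [h1.fderiv, smul_apply, hqd, h4, smul_eq_mul]
    have h5 := (hden x).ne'
    have h6 : A + ‖x‖ ^ 2 ≠ 0 := by positivity
    simp only [q]
    field_simp
    ring
  have hqlow : ∀ x, A⁻¹ ≤ q x := by
    intro x
    rw [inv_eq_one_div, div_le_div_iff₀ hApos (hden x)]
    nlinarith [sq_nonneg ‖x‖]
  have hc : ∀ x, A⁻¹ ^ ((d : ℝ) / 2) * (1 / (2 * A)) ≤ h x + 1 / d * fderiv ℝ h x x := by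
    intro x
    rw [hL]
    have h6 : 0 < A + ‖x‖ ^ 2 := by positivity
    refine mul_le_mul (Real.rpow_le_rpow (by positivity) (hqlow x) (by positivity)) ?_ (by positivity)
      (Real.rpow_nonneg (hqpos x).le _)
    rw [div_le_div_iff₀ (by positivity) (mul_pos (hden x) h6)]
    set s := ‖x‖ ^ 2
    have hs0 : 0 ≤ s := by positivity
    have e1 : A ≤ A ^ 2 := by nlinarith
    have e2 : 1 ≤ A ^ 2 := by nlinarith
    nlinarith [mul_nonneg (by positivity : 0 ≤ A ^ 2) (sq_nonneg (s - 1)), mul_nonneg hs0 hApos.le, mul_nonneg (sq_nonneg s) (sub_nonneg.2 e1), mul_nonneg hs0 (sub_nonneg.2 hA1)]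
  have hc0 : 0 < A⁻¹ ^ ((d : ℝ) / 2) * (1 / (2 * A)) := by positivity
  obtain ⟨k1, k2, k3⟩ := radial hd hs hc0 hc
  refine ⟨_, k1, ⟨_, hc0, fun x => ?_⟩, fun x => ?_, fun x hx => ?_⟩
  · rw [k2]; exact hc x
  · refine radial_ball hd (hs.differentiable (by simp)) hc0 hc 1 one_pos 1 zero_le_one ?_ _ k3 x
    intro y hy
    have : q y = 1 := by
      simp only [q, hy]
      rw [div_eq_one_iff_eq (by positivity)]; ring
    simp [h, this]
  · let w : ℝ := (a ^ 2 * ((A + a ^ 2) / (1 + A * a ^ 2))) ^ ((1:ℝ) / 2)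
    have hden' : 0 < 1 + A * a ^ 2 := by positivity
    refine (radial_ball hd (hs.differentiable (by simp)) hc0 hc a ha w (by positivity) ?_ _ k3 x).1 ?_
    · intro y hy
      simp only [h, q, hy, w]
      rw [← Real.rpow_natCast (_ ^ _) d, ← Real.rpow_mul (by positivity),
        Real.mul_rpow (by positivity) (by positivity), show (1:ℝ) / 2 * d = d / 2 by ring]
      congr 1
      rw [← Real.rpow_natCast a 2, ← Real.rpow_mul (by positivity), ← Real.rpow_natCast]
      congr 1
      push_cast; ring
    · refine hx.trans ?_
      simp only [w]
      rw [← Real.sqrt_eq_rpow]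
      apply Real.le_sqrt_of_sq_le
      rw [← mul_div_assoc, le_div_iff₀ hden']
      exact hA


/-- Radial average with `h + (1/d) x·∇h = f`. -/
theorem exists_hf {d : ℕ} (hd : 1 ≤ d) {f : EE d → ℝ} (hf : ContDiff ℝ (⊤ : ℕ∞) f) :
    ∃ h : EE d → ℝ, ContDiff ℝ (⊤ : ℕ∞) h ∧ ∀ x, h x + 1 / d * fderiv ℝ h x x = f x := by
  have hd0 : (d : ℝ) ≠ 0 := by positivity
  let h : EE d → ℝ := fun x => ∫ s in (0:ℝ)..1, d * (s ^ (d - 1) * f (s • x))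
  have hs : ContDiff ℝ (⊤ : ℕ∞) h := by
    refine contDiff_param 0 1 (fun (x : EE d) s => d * (s ^ (d - 1) * f (s • x))) ?_
    refine contDiff_const.mul (ContDiff.mul (by fun_prop) (hf.comp (by fun_prop)))
  refine ⟨h, hs, fun x => ?_⟩
  have h1 := radial_deriv hd (hs.differentiable (by simp)) x 1
  have hcont : Continuous (fun s : ℝ => d * (s ^ (d - 1) * f (s • x))) := by
    have := hf.continuous
    fun_prop
  have h2 : ∀ t : ℝ, t ^ d * h (t • x) = ∫ s in (0:ℝ)..t, d * (s ^ (d - 1) * f (s • x)) := by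
    intro t
    have h3 := intervalIntegral.mul_integral_comp_mul_left (a := 0) (b := 1)
      (f := fun s : ℝ => d * (s ^ (d - 1) * f (s • x))) t
    simp only [mul_zero, mul_one] at h3
    rw [← h3]
    have : t ^ d = t * t ^ (d - 1) := by rw [← pow_succ']; congr 1; omega
    rw [this, mul_assoc]
    congr 1
    simp only [h]
    rw [← intervalIntegral.integral_const_mul]
    congr 1
    funext s
    rw [smul_smul, mul_comm s t, mul_pow]
    ring
  simp only [h2] at h1
  have h4 := intervalIntegral.integral_hasDerivAt_right (hcont.intervalIntegrable 0 1)
    (hcont.stronglyMeasurableAtFilter _ _) hcont.continuousAt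
  have h5 := h1.unique h4
  simp only [one_pow, one_smul, mul_one, one_mul] at h5
  exact mul_left_cancel₀ hd0 h5

theorem exists_psi {d : ℕ} (hd : 1 ≤ d) {f : EE d → ℝ} (hf : ContDiff ℝ (⊤ : ℕ∞) f) {c : ℝ}
    (hc0 : 0 < c) (hc : ∀ x, c ≤ f x) {r : ℝ} (hr : 0 < r) :
    ∃ (ψ : EE d → EE d) (b : ℝ), IsSmoothDiffeo ψ ∧ 0 ≤ b ∧ b < 1 ∧ (∃ c > 0, ∀ x, c ≤ jac ψ x) ∧
      (∀ x, ‖ψ x‖ ≤ r ↔ ‖x‖ ≤ 1) ∧ (∀ x, b < ‖x‖ → jac ψ x = f x) := by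
  have hd0 : (d : ℝ) ≠ 0 := by positivity
  have hdp : 0 < (d : ℝ) := by positivity
  obtain ⟨hf1, hf1s, hf1L⟩ := exists_hf hd hf
  set m : ℝ := r ^ d with hm
  have hmpos : 0 < m := by positivity
  let p : EE d → ℝ := fun x => (m - hf1 (‖x‖⁻¹ • x)) / ‖x‖ ^ d
  let w : EE d → ℝ := fun x => hf1 x + p x
  have hps : ∀ x ≠ 0, ContDiffAt ℝ (⊤ : ℕ∞) p x := by
    intro x hx
    have hn : ContDiffAt ℝ (⊤ : ℕ∞) (fun x : EE d => ‖x‖) x := contDiffAt_norm ℝ hx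
    have hn0 : ‖x‖ ≠ 0 := norm_ne_zero_iff.2 hx
    refine ContDiffAt.div (contDiffAt_const.sub ?_) (hn.pow d) (pow_ne_zero _ hn0)
    exact hf1s.contDiffAt.comp x ((hn.inv hn0).smul contDiffAt_id)
  have hws : ∀ x ≠ 0, ContDiffAt ℝ (⊤ : ℕ∞) w x := fun x hx => hf1s.contDiffAt.add (hps x hx)
  have hw1 : ∀ x, ‖x‖ = 1 → w x = m := by
    intro x hx; simp [w, p, hx]
  let U : Set (EE d) := {x | x ≠ 0 ∧ m / 2 < w x}
  have hU : IsOpen U := by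
    rw [isOpen_iff_mem_nhds]
    rintro x ⟨hx, hxw⟩
    filter_upwards [isOpen_ne.mem_nhds hx, (hws x hx).continuousAt.eventually_const_lt hxw] with y hy hy2
    exact ⟨hy, hy2⟩
  have hsU : Metric.sphere (0 : EE d) 1 ⊆ U := by
    intro x hx
    have hx1 : ‖x‖ = 1 := by simpa using hx
    refine ⟨fun h => by simp [h] at hx1, ?_⟩
    rw [hw1 x hx1]; linarith
  obtain ⟨ε, hε, hεU⟩ := (isCompact_sphere (0 : EE d) 1).exists_thickening_subset_open hU hsU
  obtain ⟨b0, hb0, hb01, hbU⟩ : ∃ b0 : ℝ, 0 < b0 ∧ b0 < 1 ∧ ∀ x : EE d, b0 ≤ ‖x‖ → ‖x‖ ≤ 1 → x ∈ U := by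
    refine ⟨max (1 / 2) (1 - ε / 2), lt_max_of_lt_left (by norm_num), max_lt (by norm_num) (by linarith), ?_⟩
    intro x hx hx1
    have h1 := (le_max_left _ _).trans hx
    have h2 := (le_max_right _ _).trans hx
    have hxn : 0 < ‖x‖ := by linarith
    refine hεU (Metric.mem_thickening_iff.2 ⟨‖x‖⁻¹ • x, ?_, ?_⟩)
    · simp [norm_smul, hxn.ne']
    · rw [dist_eq_norm]
      have : x - ‖x‖⁻¹ • x = (1 - ‖x‖⁻¹) • x := by rw [sub_smul, one_smul]
      rw [this, norm_smul, Real.norm_eq_abs]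
      have h3 : |1 - ‖x‖⁻¹| * ‖x‖ = |(1 - ‖x‖⁻¹) * ‖x‖| := by rw [abs_mul, abs_of_pos hxn]
      rw [h3, sub_mul, inv_mul_cancel₀ hxn.ne', one_mul, abs_lt]
      constructor <;> linarith
  obtain ⟨b, hb0b, hb1⟩ := exists_between hb01
  have hbb : 0 < b ^ 2 - b0 ^ 2 := by nlinarith
  let L : ℝ → ℝ := fun s => (s - b0 ^ 2) / (b ^ 2 - b0 ^ 2)
  let η : EE d → ℝ := fun x => Real.smoothTransition (L (‖x‖ ^ 2))
  have hηs : ContDiff ℝ (⊤ : ℕ∞) η := by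
    refine Real.smoothTransition.contDiff.comp ?_
    exact ((contDiff_norm_sq ℝ).sub contDiff_const).div_const _
  have hη0 : ∀ x, ‖x‖ ≤ b0 → η x = 0 := by
    intro x hx
    refine Real.smoothTransition.zero_of_nonpos (div_nonpos_of_nonpos_of_nonneg ?_ hbb.le)
    have := norm_nonneg x
    nlinarith
  have hη1 : ∀ x, b ≤ ‖x‖ → η x = 1 := by
    intro x hx
    refine Real.smoothTransition.one_of_one_le ?_
    rw [le_div_iff₀ hbb]
    nlinarith
  have hη01 : ∀ x, 0 ≤ η x ∧ η x ≤ 1 := fun x =>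
    ⟨Real.smoothTransition.nonneg _, Real.smoothTransition.le_one _⟩
  set δ := m / 2 with hδ
  have hδpos : 0 < δ := by positivity
  let h : EE d → ℝ := fun x => η x * w x + (1 - η x) * δ
  have hloc : ∀ x, ‖x‖ < b0 → h =ᶠ[𝓝 x] fun _ => δ := by
    intro x hx
    have : {y : EE d | ‖y‖ < b0} ∈ 𝓝 x := (isOpen_lt continuous_norm continuous_const).mem_nhds hx
    filter_upwards [this] with y hy
    simp [h, hη0 y (le_of_lt hy)]
  have hs : ContDiff ℝ (⊤ : ℕ∞) h := by
    rw [contDiff_iff_contDiffAt]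
    intro x
    by_cases hx : ‖x‖ < b0
    · exact contDiffAt_const.congr_of_eventuallyEq (hloc x hx)
    · have hx0 : x ≠ 0 := by
        rintro rfl; simp at hx; linarith
      exact (hηs.contDiffAt.mul (hws x hx0)).add ((contDiffAt_const.sub hηs.contDiffAt).mul contDiffAt_const)
  have hhd : Differentiable ℝ h := hs.differentiable (by simp)
  have hpL : ∀ x ≠ 0, fderiv ℝ p x x = - d * p x := by
    intro x hx
    have h1 := fderiv_radial ((hps x hx).differentiableAt (by simp))
    have hn0 : ‖x‖ ≠ 0 := norm_ne_zero_iff.2 hx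
    have h2 : (fun t : ℝ => p (t • x)) =ᶠ[𝓝 1] fun t => p x * (t ^ d)⁻¹ := by
      filter_upwards [lt_mem_nhds (zero_lt_one' ℝ)] with t ht
      have e1 : ‖t • x‖⁻¹ • t • x = ‖x‖⁻¹ • x := by
        rw [norm_smul, smul_smul, Real.norm_of_nonneg ht.le]
        congr 1
        field_simp
      simp only [p, e1]
      rw [norm_smul, Real.norm_of_nonneg ht.le, mul_pow]
      field_simp
    have h3 := ((hasDerivAt_pow d (1:ℝ)).inv (by simp)).const_mul (p x)
    have h4 := h1.unique (h3.congr_of_eventuallyEq h2)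
    rw [h4]
    simp
    ring
  have hwL : ∀ x ≠ 0, w x + 1 / d * fderiv ℝ w x x = f x := by
    intro x hx
    have h1 : fderiv ℝ w x = fderiv ℝ hf1 x + fderiv ℝ p x :=
      fderiv_add (hf1s.differentiable (by simp) x) ((hps x hx).differentiableAt (by simp))
    rw [h1, add_apply, hpL x hx, ← hf1L x]
    simp only [w]
    field_simp
    ring
  have hLh : ∀ x ≠ 0, h x + 1 / d * fderiv ℝ h x x =
      η x * f x + (1 - η x) * δ + 1 / d * fderiv ℝ η x x * (w x - δ) := by
    intro x hx
    have e1 := (hηs.differentiable (by simp) x).hasFDerivAt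
    have e2 := ((hws x hx).differentiableAt (by simp)).hasFDerivAt
    have e3 := ((e1.mul e2).add ((e1.const_sub 1).mul_const δ)).fderiv
    have e4 : fderiv ℝ h x = _ := e3
    rw [e4, ← hwL x hx]
    simp only [add_apply, smul_apply, neg_apply, smul_eq_mul, h]
    ring
  have hηL : ∀ x, 0 ≤ fderiv ℝ η x x := by
    intro x
    have h1 := fderiv_radial (hηs.differentiable (by simp) x)
    have hn : ∀ t : ℝ, ‖t • x‖ ^ 2 = t ^ 2 * ‖x‖ ^ 2 := by
      intro t; rw [norm_smul, mul_pow, Real.norm_eq_abs, sq_abs]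
    simp only [η, hn, L] at h1
    have h2 : HasDerivAt (fun t : ℝ => (t ^ 2 * ‖x‖ ^ 2 - b0 ^ 2) / (b ^ 2 - b0 ^ 2))
        ((2 * ‖x‖ ^ 2) / (b ^ 2 - b0 ^ 2)) 1 := by
      simpa using (((hasDerivAt_pow 2 (1:ℝ)).mul_const (‖x‖ ^ 2)).sub_const (b0 ^ 2)).div_const (b ^ 2 - b0 ^ 2)
    have h3 : DifferentiableAt ℝ Real.smoothTransition ((1 ^ 2 * ‖x‖ ^ 2 - b0 ^ 2) / (b ^ 2 - b0 ^ 2)) :=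
      (Real.smoothTransition.contDiffAt (n := 1)).differentiableAt (by simp)
    have h4 := h3.hasDerivAt.comp (1:ℝ) h2
    rw [h1.unique h4]
    exact mul_nonneg Real.smoothTransition.monotone.deriv_nonneg (by positivity)
  have hηL1 : ∀ x, b < ‖x‖ → fderiv ℝ η x = 0 := by
    intro x hx
    have : η =ᶠ[𝓝 x] fun _ => 1 := by
      filter_upwards [(isOpen_lt continuous_const continuous_norm).mem_nhds hx] with y hy
      exact hη1 y (le_of_lt hy)
    rw [this.fderiv_eq]; simp
  have hc1 : 0 < min c δ := lt_min hc0 hδpos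
  have hclow : ∀ x, min c δ ≤ h x + 1 / d * fderiv ℝ h x x := by
    intro x
    by_cases hx : ‖x‖ < b0
    · rw [(hloc x hx).fderiv_eq, (hloc x hx).eq_of_nhds]
      simp
    have hx0 : x ≠ 0 := by
      rintro rfl; simp at hx; linarith
    rw [hLh x hx0]
    have h1 : 0 ≤ 1 / d * fderiv ℝ η x x * (w x - δ) := by
      by_cases hxb : b < ‖x‖
      · rw [hηL1 x hxb]; simp
      · refine mul_nonneg (mul_nonneg (by positivity) (hηL x)) ?_
        have := (hbU x (not_lt.1 hx) ((not_lt.1 hxb).trans hb1.le)).2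
        linarith
    have h2 := hη01 x
    have h3 := mul_le_mul_of_nonneg_left ((min_le_left c δ).trans (hc x)) h2.1
    have h4 := mul_le_mul_of_nonneg_left (min_le_right c δ) (sub_nonneg.2 h2.2)
    linarith
  obtain ⟨k1, k2, k3⟩ := radial hd hs hc1 hclow
  refine ⟨_, b, k1, by linarith, hb1, ⟨_, hc1, fun x => ?_⟩, fun x => ?_, fun x hx => ?_⟩
  · rw [k2]; exact hclow x
  · refine radial_ball hd hhd hc1 hclow 1 one_pos r hr.le ?_ _ k3 x
    intro y hy
    simp [h, hη1 y (by rw [hy]; exact hb1.le), hw1 y hy, hm]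
  · have hx0 : x ≠ 0 := by
      rintro rfl; simp at hx; linarith
    rw [k2, hLh x hx0, hηL1 x hx, hη1 x hx.le]
    simp


/-- Replace the `i`-th coordinate. -/
noncomputable def upd {d : ℕ} (i : Fin d) (x : EE d) (s : ℝ) : EE d :=
  x + (s - x i) • EuclideanSpace.single i (1 : ℝ)

theorem upd_same {d : ℕ} (i : Fin d) (x : EE d) (s : ℝ) : upd i x s i = s := by
  simp [upd]

theorem upd_ne {d : ℕ} {i j : Fin d} (h : j ≠ i) (x : EE d) (s : ℝ) : upd i x s j = x j := by
  simp [upd, h]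

theorem upd_self {d : ℕ} (i : Fin d) (x : EE d) : upd i x (x i) = x := by
  simp [upd]

theorem upd_congr {d : ℕ} {i : Fin d} {x y : EE d} (h : ∀ j, j ≠ i → x j = y j) (s : ℝ) :
    upd i x s = upd i y s := by
  ext j
  by_cases hj : j = i
  · subst hj; rw [upd_same, upd_same]
  · rw [upd_ne hj, upd_ne hj, h j hj]

theorem upd_upd {d : ℕ} (i : Fin d) (x : EE d) (s t : ℝ) : upd i (upd i x s) t = upd i x t :=
  upd_congr (fun _ hj => upd_ne hj x s) t

theorem contDiff_coord {d : ℕ} (i : Fin d) : ContDiff ℝ (⊤ : ℕ∞) (fun x : EE d => x i) :=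
  (EuclideanSpace.proj i : EE d →L[ℝ] ℝ).contDiff

theorem contDiff_upd {d : ℕ} (i : Fin d) :
    ContDiff ℝ (⊤ : ℕ∞) (fun p : EE d × ℝ => upd i p.1 p.2) := by
  unfold upd
  exact contDiff_fst.add ((contDiff_snd.sub ((contDiff_coord i).comp contDiff_fst)).smul
    contDiff_const)

theorem continuous_line {d : ℕ} (i : Fin d) (x : EE d) {f : EE d → ℝ} (hf : Continuous f) :
    Continuous (fun s => f (upd i x s)) :=
  hf.comp ((contDiff_upd i).continuous.comp (Continuous.prodMk_right x))

/-- Primitive in the `i`-th direction. -/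
noncomputable def prim {d : ℕ} (a : ℝ) (i : Fin d) (f : EE d → ℝ) (x : EE d) : ℝ :=
  ∫ s in (-a)..(x i), f (upd i x s)

theorem prim_contDiff {d : ℕ} (a : ℝ) (i : Fin d) {f : EE d → ℝ} (hf : ContDiff ℝ (⊤ : ℕ∞) f) :
    ContDiff ℝ (⊤ : ℕ∞) (prim a i f) := by
  have h : prim a i f = fun x => (x i + a) * ∫ t in (0:ℝ)..1, f (upd i x (-a + (x i + a) * t)) := by
    funext x
    have := intervalIntegral.mul_integral_comp_add_mul (a := 0) (b := 1) (f := fun s => f (upd i x s))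
      (x i + a) (-a)
    rw [this]
    simp [prim]
  rw [h]
  refine ((contDiff_coord i).add contDiff_const).mul (contDiff_param 0 1 _ ?_)
  have h2 : ContDiff ℝ (⊤ : ℕ∞) (fun p : EE d × ℝ => (p.1, -a + (p.1 i + a) * p.2)) := by
    refine contDiff_fst.prodMk ?_
    exact contDiff_const.add ((((contDiff_coord i).comp contDiff_fst).add contDiff_const).mul
      contDiff_snd)
  exact hf.comp ((contDiff_upd i).comp h2)

theorem prim_upd {d : ℕ} (a : ℝ) (i : Fin d) (f : EE d → ℝ) (x : EE d) (t : ℝ) :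
    prim a i f (upd i x t) = ∫ s in (-a)..t, f (upd i x s) := by
  simp only [prim, upd_same, upd_upd]

/-- One-dimensional rearrangement along coordinate `i`. -/
noncomputable def slide {d : ℕ} (a : ℝ) (i : Fin d) (f : EE d → ℝ) (x : EE d) : EE d :=
  upd i x (prim a i f x)

theorem line_deriv {d : ℕ} (a : ℝ) (i : Fin d) {f : EE d → ℝ} (hf : Continuous f) (x : EE d)
    (t : ℝ) : HasDerivAt (fun t => ∫ s in (-a)..t, f (upd i x s)) (f (upd i x t)) t := by
  have hc := continuous_line i x hf
  exact intervalIntegral.integral_hasDerivAt_right (hc.intervalIntegrable _ _)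
    (hc.stronglyMeasurableAtFilter _ _) hc.continuousAt

theorem line_bij {G g : ℝ → ℝ} (hG : ∀ t, HasDerivAt G (g t) t) {c : ℝ} (hc : 0 < c)
    (hg : ∀ t, c ≤ g t) : Function.Bijective G := by
  have hmono : Monotone (fun t => G t - c * t) := by
    have hd : ∀ t, HasDerivAt (fun t => G t - c * t) (g t - c * 1) t := fun t =>
      (hG t).sub ((hasDerivAt_id t).const_mul c)
    refine monotone_of_deriv_nonneg (fun t => (hd t).differentiableAt) fun t => ?_
    rw [(hd t).deriv]
    linarith [hg t]
  have hcont : Continuous G := continuous_iff_continuousAt.2 fun t => (hG t).continuousAt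
  constructor
  · have : StrictMono G := by
      intro s t hst
      have := hmono hst.le
      simp only at this
      nlinarith
    exact this.injective
  · refine hcont.surjective ?_ ?_
    · refine tendsto_atTop_mono' atTop (f₁ := fun t => G 0 + c * t) ?_ ?_
      · filter_upwards [eventually_ge_atTop 0] with t ht
        have := hmono ht
        simp only at this
        linarith
      · exact tendsto_atTop_add_const_left _ _ (tendsto_id.const_mul_atTop hc)
    · refine tendsto_atBot_mono' atBot (f₁ := fun t => G 0 + c * t) ?_ ?_
      · filter_upwards [eventually_le_atBot 0] with t ht
        have := hmono ht
        simp only at this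
        linarith
      · exact tendsto_atBot_add_const_left _ _ (tendsto_id.const_mul_atBot hc)

theorem slide_diffeo {d : ℕ} (a : ℝ) (i : Fin d) {f : EE d → ℝ} (hf : ContDiff ℝ (⊤ : ℕ∞) f)
    {c : ℝ} (hc : 0 < c) (hfc : ∀ x, c ≤ f x) :
    IsSmoothDiffeo (slide a i f) ∧ ∀ x, jac (slide a i f) x = f x := by
  have hsm : ContDiff ℝ (⊤ : ℕ∞) (slide a i f) :=
    (contDiff_upd i).comp (contDiff_id.prodMk (prim_contDiff a i hf))
  have hdet : ∀ x, (fderiv ℝ (slide a i f) x).det = f x := by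
    intro x
    have h1 : HasFDerivAt (prim a i f) (fderiv ℝ (prim a i f) x) x :=
      ((prim_contDiff a i hf).differentiable (by simp) x).hasFDerivAt
    set Lf := fderiv ℝ (prim a i f) x with hLf
    have h2 : HasFDerivAt (fun x : EE d => x i) (EuclideanSpace.proj i : EE d →L[ℝ] ℝ) x :=
      (EuclideanSpace.proj i : EE d →L[ℝ] ℝ).hasFDerivAt
    have h3 : HasFDerivAt (slide a i f) (ContinuousLinearMap.id ℝ (EE d) +
        (Lf - (EuclideanSpace.proj i : EE d →L[ℝ] ℝ)).smulRight (EuclideanSpace.single i (1:ℝ))) x :=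
      (hasFDerivAt_id x).add ((h1.sub h2).smul_const _)
    have h4 : Lf (EuclideanSpace.single i (1:ℝ)) = f x := by
      have hl : HasDerivAt (fun t : ℝ => upd i x t) (EuclideanSpace.single i (1:ℝ)) (x i) := by
        have := (((hasDerivAt_id (x i)).sub_const (x i)).smul_const
          (EuclideanSpace.single i (1:ℝ))).const_add x
        rw [one_smul] at this
        exact this
      have h1' : HasFDerivAt (prim a i f) Lf (upd i x (x i)) := by rw [upd_self]; exact h1
      have h5 := h1'.comp_hasDerivAt (x i) hl
      have h6 : (prim a i f ∘ fun t : ℝ => upd i x t) = fun t => ∫ s in (-a)..t, f (upd i x s) :=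
        funext fun t => prim_upd a i f x t
      rw [h6] at h5
      have := h5.unique (line_deriv a i hf.continuous x (x i))
      rw [this, upd_self]
    rw [h3.fderiv]
    have := det_rank_one 1 one_ne_zero (Lf - (EuclideanSpace.proj i : EE d →L[ℝ] ℝ))
      (EuclideanSpace.single i (1:ℝ))
    rw [one_smul] at this
    rw [this, sub_apply, h4]
    simp
  have hline : ∀ x, Function.Bijective (fun t => ∫ s in (-a)..t, f (upd i x s)) := fun x =>
    line_bij (line_deriv a i hf.continuous x) hc (fun t => hfc _)
  refine ⟨isSmoothDiffeo_of hsm ⟨?_, ?_⟩ fun x => ?_, fun x => ?_⟩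
  · intro x y hxy
    have hne : ∀ j, j ≠ i → x j = y j := by
      intro j hj
      have := congrArg (fun z : EE d => z j) hxy
      simpa [slide, upd_ne hj] using this
    have hi : prim a i f x = prim a i f y := by
      have := congrArg (fun z : EE d => z i) hxy
      simpa [slide, upd_same] using this
    have hy : y = upd i x (y i) := by rw [upd_congr hne, upd_self]
    rw [hy, prim_upd, prim] at hi
    have := (hline x).1 hi
    rw [hy, ← this, upd_self]
  · intro y
    obtain ⟨t, ht⟩ := (hline y).2 (y i)
    refine ⟨upd i y t, ?_⟩
    simp only [slide, prim_upd, upd_upd]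
    simp only at ht
    rw [ht, upd_self]
  · rw [hdet]; exact (hc.trans_le (hfc x)).ne'
  · rw [jac, hdet, abs_of_pos (hc.trans_le (hfc x))]

/-- Density transport relation by diffeomorphisms preserving the unit ball. -/
def DRel {d : ℕ} (f g : EE d → ℝ) : Prop :=
  ∃ χ : EE d → EE d, IsSmoothDiffeo χ ∧ (∀ x, ‖χ x‖ ≤ 1 ↔ ‖x‖ ≤ 1) ∧
    ∀ x, g (χ x) * jac χ x = f x

theorem DRel.refl {d : ℕ} (f : EE d → ℝ) : DRel f f := by
  refine ⟨fun x => x, ⟨contDiff_id, fun x => x, contDiff_id, fun x => rfl, fun x => rfl⟩,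
    fun x => Iff.rfl, fun x => ?_⟩
  rw [jac_id, mul_one]

theorem DRel.trans {d : ℕ} {f g h : EE d → ℝ} (h1 : DRel f g) (h2 : DRel g h) : DRel f h := by
  obtain ⟨χ, hχ, hb, he⟩ := h1
  obtain ⟨η, hη, hb', he'⟩ := h2
  refine ⟨η ∘ χ, hη.comp hχ, fun x => (hb' _).trans (hb x), fun x => ?_⟩
  rw [jac_comp hη.diff hχ.diff, ← he x, ← he' (χ x)]
  simp only [Function.comp]
  ring

theorem DRel.integral {d : ℕ} {f g : EE d → ℝ} (h : DRel f g) (hg : Continuous g)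
    (hg0 : ∀ x, 0 ≤ g x) (hf : Continuous f) (hf0 : ∀ x, 0 ≤ f x) :
    ∫ x in Metric.closedBall (0 : EE d) 1, f x = ∫ x in Metric.closedBall (0 : EE d) 1, g x := by
  obtain ⟨χ, hχ, hb, he⟩ := h
  have him : χ '' Metric.closedBall (0 : EE d) 1 = Metric.closedBall (0 : EE d) 1 := by
    ext y
    constructor
    · rintro ⟨x, hx, rfl⟩
      simp only [Metric.mem_closedBall, dist_zero_right] at hx ⊢
      exact (hb x).2 hx
    · intro hy
      obtain ⟨x, rfl⟩ := hχ.bij.2 y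
      simp only [Metric.mem_closedBall, dist_zero_right] at hy
      exact ⟨x, by simpa using (hb x).1 hy, rfl⟩
  have := hχ.lintegral_image (s := Metric.closedBall (0 : EE d) 1)
    Metric.isClosed_closedBall.measurableSet (fun x => ENNReal.ofReal (g x))
  rw [him] at this
  rw [integral_eq_lintegral_of_nonneg_ae (Eventually.of_forall hf0) hf.aestronglyMeasurable,
    integral_eq_lintegral_of_nonneg_ae (Eventually.of_forall hg0) hg.aestronglyMeasurable, this]
  congr 2
  funext x
  rw [← he x, ENNReal.ofReal_mul (hg0 _), mul_comm]

/-- Perturbations supported in the cube with zero mean along coordinate `i`. -/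
def Good {d : ℕ} (a : ℝ) (i : Fin d) (u : EE d → ℝ) : Prop :=
  ContDiff ℝ (⊤ : ℕ∞) u ∧ (∀ x j, a < |x j| → u x = 0) ∧
    ∀ x, ∫ s in (-a)..a, u (upd i x s) = 0

theorem Good.const_mul {d : ℕ} {a : ℝ} {i : Fin d} {u : EE d → ℝ} (h : Good a i u) (k : ℝ) :
    Good a i (fun x => k * u x) := by
  refine ⟨contDiff_const.mul h.1, fun x j hj => ?_, fun x => ?_⟩
  · simp only [h.2.1 x j hj, mul_zero]
  · rw [intervalIntegral.integral_const_mul, h.2.2 x, mul_zero]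

theorem Good.prim_zero {d : ℕ} {a : ℝ} {i : Fin d} {u : EE d → ℝ} (h : Good a i u)
    {x : EE d} {j : Fin d} (hj : a < |x j|) : prim a i u x = 0 := by
  obtain ⟨hu, hz, hi⟩ := h
  by_cases hji : j = i
  · subst hji
    rcases lt_abs.1 hj with h1 | h1
    · have hcu := continuous_line j x hu.continuous
      rw [prim, ← intervalIntegral.integral_add_adjacent_intervals
        (hcu.intervalIntegrable (-a) a) (hcu.intervalIntegrable a (x j)), hi, zero_add]
      refine intervalIntegral.integral_zero_ae (Eventually.of_forall fun s hs => ?_)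
      rw [uIoc_of_le h1.le] at hs
      refine hz _ j ?_
      rw [upd_same]
      exact hs.1.trans_le (le_abs_self s)
    · rw [prim, intervalIntegral.integral_symm, neg_eq_zero, intervalIntegral.integral_of_le
        (by linarith), ← MeasureTheory.integral_Ico_eq_integral_Ioc]
      refine setIntegral_eq_zero_of_forall_eq_zero fun s hs => ?_
      refine hz _ j ?_
      rw [upd_same]
      exact lt_of_lt_of_le (by linarith [hs.2]) (neg_le_abs s)
  · rw [prim]
    refine intervalIntegral.integral_zero_ae (Eventually.of_forall fun s _ => ?_)
    refine hz _ j ?_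
    rw [upd_ne hji]
    exact hj

theorem step {d : ℕ} {a : ℝ} (hK : ∀ x : EE d, (∀ j, |x j| ≤ a) → ‖x‖ ≤ 1)
    {i : Fin d} {f u : EE d → ℝ} (hf : ContDiff ℝ (⊤ : ℕ∞) f) (h : Good a i u) {c : ℝ}
    (hc : 0 < c) (hfc : ∀ x, c ≤ f x) (hgc : ∀ x, c ≤ f x + u x) :
    DRel f (fun x => f x + u x) := by
  have hg : ContDiff ℝ (⊤ : ℕ∞) (fun x => f x + u x) := hf.add h.1
  obtain ⟨hP, hPj⟩ := slide_diffeo a i hf hc hfc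
  obtain ⟨hQ, hQj⟩ := slide_diffeo a i hg hc hgc
  obtain ⟨R, hR, hR1, hR2⟩ := hQ.exists_inv
  have hoff : ∀ x : EE d, (∃ j, a < |x j|) → R (slide a i f x) = x := by
    rintro x ⟨j, hj⟩
    have : prim a i (fun x => f x + u x) x = prim a i f x := by
      have h0 := h.prim_zero hj
      unfold prim at h0 ⊢
      rw [intervalIntegral.integral_add
        ((continuous_line i x hf.continuous).intervalIntegrable _ _)
        ((continuous_line i x h.1.continuous).intervalIntegrable _ _), h0, add_zero]
    have h2 : slide a i f x = slide a i (fun x => f x + u x) x := by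
      rw [slide, slide, this]
    rw [h2, hR1]
  have hχ := hR.comp hP
  refine ⟨R ∘ slide a i f, hχ, fun x => ?_, fun x => ?_⟩
  · by_cases hx : ∃ j, a < |x j|
    · simp only [Function.comp, hoff x hx]
    · push Not at hx
      refine ⟨fun _ => hK x hx, fun _ => ?_⟩
      by_contra hcon
      have : ∃ j, a < |((R ∘ slide a i f) x) j| := by
        by_contra h'
        push Not at h'
        exact hcon (hK _ h')
      have h3 := hχ.bij.1 (hoff _ this)
      rw [h3] at hcon
      exact hcon (hK x hx)
  · have hcomp : slide a i (fun x => f x + u x) ∘ (R ∘ slide a i f) = slide a i f :=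
      funext fun x => hR2 _
    have := jac_comp hQ.diff hχ.diff x
    rw [hcomp, hPj, hQj] at this
    exact this.symm


theorem chain_small {d : ℕ} {a : ℝ} (hK : ∀ x : EE d, (∀ j, |x j| ≤ a) → ‖x‖ ≤ 1)
    {f : EE d → ℝ} (hf : ContDiff ℝ (⊤ : ℕ∞) f) {c : ℝ} (hc : 0 < c) (hfc : ∀ x, c ≤ f x)
    {v : Fin d → EE d → ℝ} (hv : ∀ i, Good a i (v i)) (hb : ∀ x, ∑ i, |v i x| ≤ c / 2)
    (S : Finset (Fin d)) : DRel f (fun x => f x + ∑ i ∈ S, v i x) := by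
  have hlow : ∀ (S : Finset (Fin d)) (x : EE d), c / 2 ≤ f x + ∑ i ∈ S, v i x := by
    intro S x
    have h1 : |∑ i ∈ S, v i x| ≤ c / 2 :=
      (Finset.abs_sum_le_sum_abs _ _).trans ((Finset.sum_le_univ_sum_of_nonneg
        (fun i => abs_nonneg _)).trans (hb x))
    linarith [hfc x, neg_abs_le (∑ i ∈ S, v i x)]
  have hsm : ∀ (S : Finset (Fin d)), ContDiff ℝ (⊤ : ℕ∞) (fun x => f x + ∑ i ∈ S, v i x) :=
    fun S => hf.add (ContDiff.sum fun i _ => (hv i).1)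
  induction S using Finset.induction_on with
  | empty => simpa using DRel.refl f
  | insert i S hi ih =>
    refine ih.trans ?_
    have heq : (fun x => f x + ∑ j ∈ insert i S, v j x) =
        fun x => (f x + ∑ j ∈ S, v j x) + v i x := by
      funext x
      rw [Finset.sum_insert hi]
      ring
    have h2 := hlow (insert i S)
    rw [heq]
    refine step hK (hsm S) (hv i) (half_pos hc) (hlow S) (fun x => ?_)
    have := congrFun heq x
    exact (h2 x).trans_eq this

theorem good_bound {d : ℕ} {a : ℝ} (hK : ∀ x : EE d, (∀ j, |x j| ≤ a) → ‖x‖ ≤ 1)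
    {v : Fin d → EE d → ℝ} (hv : ∀ i, Good a i (v i)) :
    ∃ M, 0 < M ∧ ∀ x, ∑ i, |v i x| ≤ M := by
  have hcont : Continuous (fun x => ∑ i, |v i x|) :=
    continuous_finsetSum _ fun i _ => (hv i).1.continuous.abs
  obtain ⟨C, hC⟩ := (isCompact_closedBall (0 : EE d) 1).exists_bound_of_continuousOn
    hcont.continuousOn
  refine ⟨max C 1, by positivity, fun x => ?_⟩
  by_cases hx : ∀ j, |x j| ≤ a
  · have := hC x (by simpa using hK x hx)
    exact (le_abs_self _).trans (this.trans (le_max_left _ _))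
  · push Not at hx
    obtain ⟨j, hj⟩ := hx
    have : ∑ i, |v i x| = 0 :=
      Finset.sum_eq_zero fun i _ => by rw [(hv i).2.1 x j hj, abs_zero]
    rw [this]
    positivity

theorem chain {d : ℕ} {a : ℝ} (hK : ∀ x : EE d, (∀ j, |x j| ≤ a) → ‖x‖ ≤ 1)
    {f : EE d → ℝ} (hf : ContDiff ℝ (⊤ : ℕ∞) f) {c : ℝ} (hc : 0 < c) (hfc : ∀ x, c ≤ f x)
    {v : Fin d → EE d → ℝ} (hv : ∀ i, Good a i (v i))
    (hg : ∀ x, c ≤ f x + ∑ i, v i x) : DRel f (fun x => f x + ∑ i, v i x) := by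
  obtain ⟨M, hM, hb⟩ := good_bound hK hv
  obtain ⟨n, hn⟩ := exists_nat_gt (2 * M / c)
  have hn0 : (0 : ℝ) < n := lt_trans (by positivity) hn
  have key : ∀ k : ℕ, k ≤ n → DRel f (fun x => f x + (k / n : ℝ) * ∑ i, v i x) := by
    intro k
    induction k with
    | zero => intro _; simpa using DRel.refl f
    | succ k ih =>
      intro hk
      refine (ih (by omega)).trans ?_
      have hk' : (k : ℝ) ≤ n := by exact_mod_cast (by omega : k ≤ n)
      have hkn : (k / n : ℝ) ≤ 1 := by rw [div_le_one hn0]; exact hk'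
      have hkn0 : 0 ≤ (k / n : ℝ) := by positivity
      have h1 := chain_small hK (f := fun x => f x + (k / n : ℝ) * ∑ i, v i x)
        (hf.add (contDiff_const.mul (ContDiff.sum fun i _ => (hv i).1))) hc
        (fun x => by nlinarith [hfc x, hg x])
        (v := fun i x => (1 / n : ℝ) * v i x) (fun i => (hv i).const_mul _)
        (fun x => by
          simp only [abs_mul]
          rw [← Finset.mul_sum, abs_of_pos (by positivity), one_div, inv_mul_le_iff₀ hn0]
          rw [div_lt_iff₀ hc] at hn
          linarith [hb x]) Finset.univ
      convert h1 using 2 with x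
      rw [← Finset.mul_sum]
      push_cast
      ring
  have := key n le_rfl
  rw [div_self hn0.ne'] at this
  simpa using this

theorem exists_bump {a : ℝ} (ha : 0 < a) : ∃ φ : ℝ → ℝ, ContDiff ℝ (⊤ : ℕ∞) φ ∧
    (∀ t, 0 ≤ φ t) ∧ 0 < φ 0 ∧ (∀ t, a < |t| → φ t = 0) ∧ ∫ s in (-a)..a, φ s = 1 := by
  let b : ContDiffBump (0 : ℝ) := ⟨a / 4, a / 2, by linarith, by linarith⟩
  have hsupp : Function.support (b.normed volume) = Metric.ball 0 (a / 2) :=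
    b.support_normed_eq
  refine ⟨b.normed volume, b.contDiff_normed, b.nonneg_normed, ?_, ?_, ?_⟩
  · refine lt_of_le_of_ne (b.nonneg_normed _) (Ne.symm ?_)
    have : (0 : ℝ) ∈ Function.support (b.normed volume) := by
      rw [hsupp]; exact Metric.mem_ball_self (by linarith)
    exact this
  · intro t ht
    by_contra hne
    have : t ∈ Function.support (b.normed volume) := hne
    rw [hsupp, Metric.mem_ball, dist_zero_right, Real.norm_eq_abs] at this
    linarith
  · rw [intervalIntegral.integral_eq_integral_of_support_subset, b.integral_normed]
    rw [hsupp]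
    intro t ht
    rw [Metric.mem_ball, dist_zero_right, Real.norm_eq_abs, abs_lt] at ht
    exact ⟨by linarith [ht.1], by linarith [ht.2]⟩

theorem decomp {d : ℕ} {a : ℝ} {φ : ℝ → ℝ} (hφ : ContDiff ℝ (⊤ : ℕ∞) φ)
    (hφ0 : ∀ t, a < |t| → φ t = 0) (hφ1 : ∫ s in (-a)..a, φ s = 1)
    {w : EE d → ℝ} (hw : ContDiff ℝ (⊤ : ℕ∞) w) (hw0 : ∀ x j, a < |x j| → w x = 0)
    (S : Finset (Fin d)) :
    ∃ m : EE d → ℝ, ContDiff ℝ (⊤ : ℕ∞) m ∧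
      (∀ x y, (∀ j, j ∉ S → x j = y j) → m x = m y) ∧
      (∀ x j, j ∉ S → a < |x j| → m x = 0) ∧
      ∃ v : Fin d → EE d → ℝ, (∀ i, Good a i (v i)) ∧
        ∀ x, w x = ∑ i ∈ S, v i x + (∏ j ∈ S, φ (x j)) * m x := by
  induction S using Finset.induction_on with
  | empty =>
    refine ⟨w, hw, fun x y h => ?_, fun x j _ => hw0 x j, fun _ _ => 0, fun i => ?_, fun x => ?_⟩
    · congr 1
      ext j
      exact h j (by simp)
    · exact ⟨contDiff_const, fun _ _ _ => rfl, fun x => by simp⟩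
    · simp
  | insert i S hi ih =>
    obtain ⟨m, hm, hmc, hm0, v, hv, he⟩ := ih
    have hm' : ContDiff ℝ (⊤ : ℕ∞) (fun x => ∫ s in (-a)..a, m (upd i x s)) :=
      contDiff_param _ _ _ (hm.comp (contDiff_upd i))
    set m' : EE d → ℝ := fun x => ∫ s in (-a)..a, m (upd i x s) with hm'def
    have hmc' : ∀ x y, (∀ j, j ∉ insert i S → x j = y j) → m' x = m' y := by
      intro x y h
      simp only [hm'def]
      congr 1
      funext s
      refine hmc _ _ fun j hj => ?_
      by_cases hji : j = i
      · subst hji; rw [upd_same, upd_same]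
      · rw [upd_ne hji, upd_ne hji]
        exact h j (by simp [hji, hj])
    have hm0' : ∀ x j, j ∉ insert i S → a < |x j| → m' x = 0 := by
      intro x j hj hx
      rw [Finset.mem_insert, not_or] at hj
      simp only [hm'def]
      refine intervalIntegral.integral_zero_ae (Eventually.of_forall fun s _ => ?_)
      refine hm0 _ j hj.2 ?_
      rw [upd_ne hj.1]
      exact hx
    set u : EE d → ℝ := fun x => (∏ j ∈ S, φ (x j)) * (m x - φ (x i) * m' x) with hu
    have hgood : Good a i u := by
      refine ⟨?_, ?_, ?_⟩
      · refine ContDiff.mul (contDiff_prod fun j _ => hφ.comp (contDiff_coord j)) ?_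
        exact hm.sub ((hφ.comp (contDiff_coord i)).mul hm')
      · intro x j hj
        simp only [hu]
        by_cases hjS : j ∈ S
        · rw [Finset.prod_eq_zero hjS (hφ0 _ hj), zero_mul]
        · by_cases hji : j = i
          · subst hji
            rw [hm0 x j hjS hj, hφ0 _ hj]
            ring
          · rw [hm0 x j hjS hj, hm0' x j (by simp [hji, hjS]) hj]
            ring
      · intro x
        have h1 : ∀ s, u (upd i x s) =
            (∏ j ∈ S, φ (x j)) * (m (upd i x s) - φ s * m' x) := by
          intro s
          simp only [hu]
          rw [upd_same]
          have h2 : m' (upd i x s) = m' x := hmc' _ _ fun j hj => upd_ne (by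
            rintro rfl; simp at hj) x s
          rw [h2]
          congr 1
          refine Finset.prod_congr rfl fun j hj => ?_
          rw [upd_ne (by rintro rfl; exact hi hj)]
        simp only [h1]
        rw [intervalIntegral.integral_const_mul, intervalIntegral.integral_sub
          ((continuous_line i x hm.continuous).intervalIntegrable _ _)
          ((hφ.continuous.mul_const (m' x)).intervalIntegrable _ _),
          intervalIntegral.integral_mul_const, hφ1]
        simp [hm'def]
    refine ⟨m', hm', hmc', hm0', Function.update v i u, fun j => ?_, fun x => ?_⟩
    · by_cases hji : j = i
      · subst hji; simpa using hgood
      · simpa [hji] using hv j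
    · rw [he x, Finset.sum_insert hi, Finset.prod_insert hi]
      have : ∑ j ∈ S, Function.update v i u j x = ∑ j ∈ S, v j x :=
        Finset.sum_congr rfl fun j hj => by
          rw [Function.update_of_ne (by rintro rfl; exact hi hj)]
      rw [this, Function.update_self]
      simp only [hu]
      ring

theorem moser {d : ℕ} {a : ℝ} (ha : 0 < a) (hK : ∀ x : EE d, (∀ j, |x j| ≤ a) → ‖x‖ ≤ 1)
    {f g : EE d → ℝ} (hf : ContDiff ℝ (⊤ : ℕ∞) f) (hg : ContDiff ℝ (⊤ : ℕ∞) g)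
    {c : ℝ} (hc : 0 < c) (hfc : ∀ x, c ≤ f x) (hgc : ∀ x, c ≤ g x)
    (hfg : ∀ x j, a < |x j| → f x = g x)
    (hint : ∫ x in Metric.closedBall (0 : EE d) 1, f x =
      ∫ x in Metric.closedBall (0 : EE d) 1, g x) : DRel f g := by
  obtain ⟨φ, hφ, hφn, hφp, hφ0, hφ1⟩ := exists_bump ha
  obtain ⟨m, hm, hmc, -, v, hv, he⟩ := decomp hφ hφ0 hφ1 (hg.sub hf)
    (fun x j hj => by simp only [hfg x j hj, sub_self]) Finset.univ
  have hB : IsCompact (Metric.closedBall (0 : EE d) 1) := isCompact_closedBall _ _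
  have hmC : ∀ x, m x = m 0 := fun x => hmc x 0 fun j hj => absurd (Finset.mem_univ j) hj
  have hvs : ContDiff ℝ (⊤ : ℕ∞) (fun x => ∑ i, v i x) := ContDiff.sum fun i _ => (hv i).1
  have hps : ContDiff ℝ (⊤ : ℕ∞) (fun x : EE d => ∏ j, φ (x j)) :=
    contDiff_prod fun j _ => hφ.comp (contDiff_coord j)
  have hv0 : ∫ x in Metric.closedBall (0 : EE d) 1, ∑ i, v i x = 0 := by
    obtain ⟨M, hM, hb⟩ := good_bound hK hv
    set ε : ℝ := c / (2 * M) with hε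
    have hεp : 0 < ε := by positivity
    have hεM : ε * M = c / 2 := by rw [hε]; field_simp
    have hlow : ∀ x, c / 2 ≤ f x + ε * ∑ i, v i x := by
      intro x
      have h1 : |∑ i, v i x| ≤ M := (Finset.abs_sum_le_sum_abs _ _).trans (hb x)
      have h2 := (abs_le.1 h1).1
      nlinarith [hfc x]
    have h1 := chain hK hf (half_pos hc) (fun x => by linarith [hfc x])
      (v := fun i x => ε * v i x) (fun i => (hv i).const_mul ε)
      (fun x => by rw [← Finset.mul_sum]; exact hlow x)
    simp only [← Finset.mul_sum] at h1
    have hcont : Continuous (fun x => ε * ∑ i, v i x) := continuous_const.mul hvs.continuous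
    have h2 := h1.integral (hf.continuous.add hcont)
      (fun x => by linarith [hlow x]) hf.continuous (fun x => by linarith [hfc x])
    rw [integral_add (hf.continuous.continuousOn.integrableOn_compact hB)
      (hcont.continuousOn.integrableOn_compact hB), integral_const_mul] at h2
    have h3 : ε * ∫ x in Metric.closedBall (0 : EE d) 1, ∑ i, v i x = 0 := by linarith
    exact (mul_eq_zero.1 h3).resolve_left hεp.ne'
  have hpp : 0 < ∫ x in Metric.closedBall (0 : EE d) 1, ∏ j, φ (x j) := by
    have hnn : ∀ x : EE d, 0 ≤ ∏ j, φ (x j) := fun x => Finset.prod_nonneg fun j _ => hφn _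
    rw [setIntegral_pos_iff_support_of_nonneg_ae (Eventually.of_forall hnn)
      (hps.continuous.continuousOn.integrableOn_compact hB)]
    have hopen : IsOpen (Function.support (fun x : EE d => ∏ j, φ (x j)) ∩
        Metric.ball (0 : EE d) 1) :=
      hps.continuous.isOpen_support.inter Metric.isOpen_ball
    refine (hopen.measure_pos volume ⟨0, ?_, Metric.mem_ball_self one_pos⟩).trans_le
      (measure_mono (inter_subset_inter_right _ Metric.ball_subset_closedBall))
    simp only [Function.mem_support]
    exact (Finset.prod_pos fun j _ => by simpa using hφp).ne'
  have hC : m 0 = 0 := by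
    have h1 : ∫ x in Metric.closedBall (0 : EE d) 1, (g x - f x) = 0 := by
      rw [integral_sub (hg.continuous.continuousOn.integrableOn_compact hB)
        (hf.continuous.continuousOn.integrableOn_compact hB), hint, sub_self]
    have h2 : ∀ x, g x - f x = ∑ i, v i x + (∏ j, φ (x j)) * m 0 := by
      intro x
      have := he x
      rw [hmC x] at this
      exact this
    simp only [h2] at h1
    rw [integral_add (hvs.continuous.continuousOn.integrableOn_compact hB)
      ((hps.continuous.mul_const (m 0)).continuousOn.integrableOn_compact hB), hv0,
      integral_mul_const, zero_add] at h1
    exact (mul_eq_zero.1 h1).resolve_left hpp.ne'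
  have hgeq : g = fun x => f x + ∑ i, v i x := by
    funext x
    have := he x
    rw [hmC x, hC, mul_zero, add_zero] at this
    linarith
  rw [hgeq] at hgc ⊢
  exact chain hK hf hc hfc hv hgc


theorem cube_subset {d : ℕ} (hd : 1 ≤ d) (x : EE d) (h : ∀ j, |x j| ≤ 1 / (d : ℝ)) : ‖x‖ ≤ 1 := by
  have hd1 : (1 : ℝ) ≤ d := by exact_mod_cast hd
  have hdp : (0 : ℝ) < d := by linarith
  have h1 : ‖x‖ ^ 2 ≤ 1 := by
    rw [EuclideanSpace.norm_sq_eq]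
    calc ∑ i, ‖x i‖ ^ 2 ≤ ∑ _i : Fin d, (1 / (d : ℝ)) ^ 2 :=
          Finset.sum_le_sum fun i _ => pow_le_pow_left₀ (norm_nonneg _) (h i) 2
      _ = 1 / (d : ℝ) := by
          rw [Finset.sum_const, Finset.card_univ, Fintype.card_fin, nsmul_eq_mul]
          field_simp
      _ ≤ 1 := by rw [div_le_one hdp]; exact hd1
  nlinarith [norm_nonneg x]

theorem exists_radius {d : ℕ} (hd : 1 ≤ d) {V : ENNReal} (h0 : V ≠ 0) (ht : V ≠ ⊤) :
    ∃ r : ℝ, 0 < r ∧ volume (Metric.closedBall (0 : EE d) r) = V := by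
  have hd0 : d ≠ 0 := by omega
  set B := volume (Metric.ball (0 : EE d) 1) with hB
  have hB0 : B ≠ 0 := (Metric.measure_ball_pos volume _ one_pos).ne'
  have hBt : B ≠ ⊤ := measure_ball_lt_top.ne
  have hVp : 0 < V.toReal := ENNReal.toReal_pos h0 ht
  have hBp : 0 < B.toReal := ENNReal.toReal_pos hB0 hBt
  have hq : 0 < V.toReal / B.toReal := by positivity
  refine ⟨(V.toReal / B.toReal) ^ ((d : ℝ)⁻¹), Real.rpow_pos_of_pos hq _, ?_⟩
  rw [Measure.addHaar_closedBall volume _ (Real.rpow_pos_of_pos hq _).le]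
  rw [finrank_euclideanSpace, Fintype.card_fin, Real.rpow_inv_natCast_pow hq.le hd0, ← hB,
    ENNReal.ofReal_div_of_pos hBp, ENNReal.ofReal_toReal ht, ENNReal.ofReal_toReal hBt,
    ENNReal.div_mul_cancel hB0 hBt]

theorem integral_jac {d : ℕ} {T : EE d → EE d} (hT : IsSmoothDiffeo T) :
    ∫ x in Metric.closedBall (0 : EE d) 1, jac T x =
      (volume (T '' Metric.closedBall (0 : EE d) 1)).toReal := by
  rw [hT.volume_image Metric.isClosed_closedBall.measurableSet,
    integral_eq_lintegral_of_nonneg_ae (Eventually.of_forall fun x => (hT.jac_pos x).le)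
      hT.contDiff_jac.continuous.aestronglyMeasurable]

theorem image_eq_of_iff {d : ℕ} {T : EE d → EE d} (hT : IsSmoothDiffeo T) {r : ℝ}
    (h : ∀ x, ‖T x‖ ≤ r ↔ ‖x‖ ≤ 1) :
    T '' Metric.closedBall (0 : EE d) 1 = Metric.closedBall (0 : EE d) r := by
  ext y
  constructor
  · rintro ⟨x, hx, rfl⟩
    simp only [Metric.mem_closedBall, dist_zero_right] at hx ⊢
    exact (h x).2 hx
  · intro hy
    obtain ⟨x, rfl⟩ := hT.bij.2 y
    simp only [Metric.mem_closedBall, dist_zero_right] at hy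
    exact ⟨x, by simpa using (h x).1 hy, rfl⟩

/-- **Any compact domain diffeomorphic to a closed ball is the sub-level set of a
volume-preserving flow-based frontier.** If `Ω ⊂ ℝ^d` is the image of the closed unit
ball under a `C^∞` diffeomorphism of `ℝ^d`, then there is a volume-preserving `C^∞`
diffeomorphism `T` of `ℝ^d` and `q > 0` with `Ω = { y | ‖T y‖² ≤ q }`; moreover `q = r²`
where `r > 0` is the radius for which the ball `B̄(0, r)` has the same volume as `Ω`. -/
theorem domain_diffeo_ball_is_sublevel_of_volume_preserving_flow
    (d : ℕ) (hd : 1 ≤ d) (Ω : Set (EuclideanSpace ℝ (Fin d)))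
    (F : EuclideanSpace ℝ (Fin d) → EuclideanSpace ℝ (Fin d))
    (hF : IsSmoothDiffeo F)
    (hΩ : Ω = F '' Metric.closedBall (0 : EuclideanSpace ℝ (Fin d)) 1) :
    ∃ (T : EuclideanSpace ℝ (Fin d) → EuclideanSpace ℝ (Fin d)) (q : ℝ),
      IsSmoothDiffeo T ∧ MeasurePreserving T volume volume ∧ 0 < q ∧
      Ω = {y : EuclideanSpace ℝ (Fin d) | ‖T y‖ ^ 2 ≤ q} ∧
      ∃ r : ℝ, 0 < r ∧ q = r ^ 2 ∧
        volume (Metric.closedBall (0 : EuclideanSpace ℝ (Fin d)) r) = volume Ω := by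
  obtain ⟨Ψ, ⟨hΨ, c, C, hc, hcb⟩, hΨF⟩ := exists_bounded hF
  have hΩΨ : Ω = Ψ '' Metric.closedBall (0 : EE d) 1 := by
    rw [hΩ]
    exact (image_congr hΨF).symm
  have hVt : volume Ω ≠ ⊤ := by
    rw [hΩΨ]
    exact ((isCompact_closedBall (0 : EE d) 1).image hΨ.1.continuous).measure_lt_top.ne
  have hV0 : volume Ω ≠ 0 := by
    obtain ⟨S, hS, hS1, hS2⟩ := hΨ.exists_inv
    have hopen : IsOpen (S ⁻¹' Metric.ball (0 : EE d) 1) :=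
      Metric.isOpen_ball.preimage hS.1.continuous
    refine ((hopen.measure_pos volume ⟨Ψ 0, ?_⟩).trans_le (measure_mono ?_)).ne'
    · simp only [mem_preimage, hS1]
      exact Metric.mem_ball_self one_pos
    · intro y hy
      rw [hΩΨ]
      exact ⟨S y, Metric.ball_subset_closedBall hy, hS2 y⟩
  obtain ⟨r, hr, hrV⟩ := exists_radius hd hV0 hVt
  obtain ⟨ψ, b, hψ, hb0, hb1, ⟨c₁, hc₁, hψc⟩, hψr, hψj⟩ :=
    exists_psi hd hΨ.contDiff_jac hc (fun x => (hcb x).1) hr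
  have hd1 : (1 : ℝ) ≤ d := by exact_mod_cast hd
  have hdp : (0 : ℝ) < d := by linarith
  have ha : 0 < 1 / (d : ℝ) := by positivity
  have ha1 : 1 / (d : ℝ) ≤ 1 := by rw [div_le_one hdp]; exact hd1
  obtain ⟨κ, hκ, ⟨c₂, hc₂, hκc⟩, hκ1, hκb⟩ := exists_kappa hd ha ha1 hb0 hb1
  have hA := hΨ.comp hκ
  have hB := hψ.comp hκ
  have hAim : (Ψ ∘ κ) '' Metric.closedBall (0 : EE d) 1 = Ω := by
    rw [image_comp, image_eq_of_iff hκ hκ1, hΩΨ]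
  have hBr : ∀ x, ‖(ψ ∘ κ) x‖ ≤ r ↔ ‖x‖ ≤ 1 := fun x => (hψr _).trans (hκ1 x)
  have hBim := image_eq_of_iff hB hBr
  have hrel : DRel (jac (Ψ ∘ κ)) (jac (ψ ∘ κ)) := by
    refine moser ha (cube_subset hd) hA.contDiff_jac hB.contDiff_jac
      (c := min c c₁ * c₂) (mul_pos (lt_min hc hc₁) hc₂) (fun x => ?_) (fun x => ?_)
      (fun x j hj => ?_) ?_
    · rw [jac_comp hΨ.diff hκ.diff]
      exact mul_le_mul ((min_le_left _ _).trans (hcb _).1) (hκc x) hc₂.le (hΨ.jac_pos _).le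
    · rw [jac_comp hψ.diff hκ.diff]
      exact mul_le_mul ((min_le_right _ _).trans (hψc _)) (hκc x) hc₂.le (hψ.jac_pos _).le
    · rw [jac_comp hΨ.diff hκ.diff, jac_comp hψ.diff hκ.diff, hψj]
      by_contra hcon
      push Not at hcon
      have h1 := hκb x hcon
      have h2 : |x j| ≤ ‖x‖ := PiLp.norm_apply_le x j
      linarith
    · rw [integral_jac hA, integral_jac hB, hAim, hBim, hrV]
  obtain ⟨χ, hχ, hχ1, hχj⟩ := hrel
  obtain ⟨R, hR, hR1, hR2⟩ := hA.exists_inv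
  have hD := hB.comp hχ
  have hT := hD.comp hR
  refine ⟨((ψ ∘ κ) ∘ χ) ∘ R, r ^ 2, hT, hT.measurePreserving fun y => ?_, by positivity, ?_,
    r, hr, rfl, hrV⟩
  · have h1 := jac_comp hA.diff hR.diff y
    have hid : (Ψ ∘ κ) ∘ R = fun y => y := funext hR2
    rw [hid, jac_id] at h1
    rw [jac_comp hD.diff hR.diff, jac_comp hB.diff hχ.diff, hχj, ← h1]
  · ext y
    rw [mem_ofPred_eq, pow_le_pow_iff_left₀ (norm_nonneg _) hr.le two_ne_zero]
    have h1 : ‖(((ψ ∘ κ) ∘ χ) ∘ R) y‖ ≤ r ↔ ‖R y‖ ≤ 1 := (hBr _).trans (hχ1 _)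
    rw [h1, ← hAim]
    constructor
    · rintro ⟨x, hx, rfl⟩
      rw [hR1]
      simpa using hx
    · intro hy
      exact ⟨R y, by simpa using hy, hR2 y⟩
end

section
/- Let d ≥ 1, let ν be a probability measure on ℝ^d, let τ ∈ (0,1), and let L be a d × d real matrix with det(L) > 0. Define Q(A) := sInf { t : ℝ | ν { z ∈ ℝ^d : ‖A z‖₂² ≤ t } ≥ τ } for any d × d matrix A, and assume q := Q(L) > 0. Then inf_{c > 0} [ −log det(c·L) + Q(c·L) ] = −log det(L) + (d/2)·log(q) + (d/2)·(1 − log(d/2)). -/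
open MeasureTheory

/-- The `τ`-quantile of the squared-Mahalanobis score `‖A z‖²` of a matrix `A`, when
`z ∼ ν`: `Q(A) = sInf { t | ν { z | ‖A z‖² ≤ t } ≥ τ }`. -/
noncomputable def mahalanobisQuantile {d : ℕ} (ν : Measure (EuclideanSpace ℝ (Fin d)))
    (τ : ℝ) (A : Matrix (Fin d) (Fin d) ℝ) : ℝ :=
  sInf {t : ℝ | ENNReal.ofReal τ ≤
    ν {z : EuclideanSpace ℝ (Fin d) | ‖Matrix.toEuclideanLin A z‖ ^ 2 ≤ t}}

theorem mahalanobisQuantile_smul {d : ℕ} (ν : Measure (EuclideanSpace ℝ (Fin d)))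
    (τ : ℝ) (A : Matrix (Fin d) (Fin d) ℝ) (c : ℝ) (hc : 0 < c) :
    mahalanobisQuantile ν τ (c • A) = c ^ 2 * mahalanobisQuantile ν τ A := by
  have hc2 : 0 < c ^ 2 := by positivity
  unfold mahalanobisQuantile
  rw [← smul_eq_mul, ← Real.sInf_smul_of_nonneg hc2.le]
  congr 1
  ext t
  rw [Set.mem_smul_set_iff_inv_smul_mem₀ hc2.ne']
  simp only [Set.mem_setOf_eq, smul_eq_mul]
  have : ∀ z : EuclideanSpace ℝ (Fin d), ‖Matrix.toEuclideanLin (c • A) z‖ ^ 2 ≤ t ↔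
      ‖Matrix.toEuclideanLin A z‖ ^ 2 ≤ (c ^ 2)⁻¹ * t := by
    intro z
    rw [map_smul, LinearMap.smul_apply, norm_smul, mul_pow, Real.norm_eq_abs, sq_abs,
      le_inv_mul_iff₀ hc2]
  simp only [this]

/-- **Equivalence of the log-volume and threshold objectives.** Minimizing
`−log det(c·L) + Q(c·L)` over all positive rescalings `c > 0` of the shape matrix `L`
yields `−log det L + (d/2)·log Q(L) + (d/2)(1 − log(d/2))`. -/
theorem inf_rescaled_objective_eq_log_volume
    (d : ℕ) (hd : 1 ≤ d) (ν : Measure (EuclideanSpace ℝ (Fin d)))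
    [IsProbabilityMeasure ν] (τ : ℝ) (hτ : τ ∈ Set.Ioo (0:ℝ) 1)
    (L : Matrix (Fin d) (Fin d) ℝ) (hdet : 0 < L.det)
    (hq : 0 < mahalanobisQuantile ν τ L) :
    sInf ((fun c : ℝ =>
        -Real.log (c • L).det + mahalanobisQuantile ν τ (c • L)) '' Set.Ioi 0)
      = -Real.log L.det + (d : ℝ) / 2 * Real.log (mahalanobisQuantile ν τ L)
        + (d : ℝ) / 2 * (1 - Real.log ((d : ℝ) / 2)) := by
  have hd' : (0 : ℝ) < (d : ℝ) / 2 := by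
    have : (1 : ℝ) ≤ d := by exact_mod_cast hd
    linarith
  have key : ∀ c : ℝ, 0 < c →
      -Real.log (c • L).det + mahalanobisQuantile ν τ (c • L)
        = -Real.log L.det - d * Real.log c + c ^ 2 * mahalanobisQuantile ν τ L := by
    intro c hc
    rw [mahalanobisQuantile_smul ν τ L c hc, Matrix.det_smul, Fintype.card_fin,
      Real.log_mul (pow_pos hc d).ne' hdet.ne', Real.log_pow]
    ring
  generalize mahalanobisQuantile ν τ L = q at *
  apply IsLeast.csInf_eq
  constructor
  · have hp : 0 < (d : ℝ) / 2 / q := div_pos hd' hq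
    refine ⟨Real.sqrt ((d : ℝ) / 2 / q), Real.sqrt_pos.2 hp, ?_⟩
    show -Real.log (_ • L).det + mahalanobisQuantile ν τ (_ • L) = _
    rw [key _ (Real.sqrt_pos.2 hp), Real.sq_sqrt hp.le, Real.log_sqrt hp.le,
      Real.log_div hd'.ne' hq.ne', div_mul_cancel₀ _ hq.ne']
    ring
  · rintro _ ⟨c, hc, rfl⟩
    have hc : 0 < c := hc
    show _ ≤ -Real.log (c • L).det + mahalanobisQuantile ν τ (c • L)
    rw [key c hc]
    have h := Real.log_le_sub_one_of_pos
      (div_pos (mul_pos (pow_pos hc 2) hq) hd')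
    rw [Real.log_div (mul_pos (pow_pos hc 2) hq).ne' hd'.ne',
      Real.log_mul (pow_pos hc 2).ne' hq.ne', Real.log_pow] at h
    have h2 := mul_le_mul_of_nonneg_left h hd'.le
    rw [mul_sub ((d : ℝ) / 2) (c ^ 2 * q / ((d : ℝ) / 2)) 1, mul_div_cancel₀ _ hd'.ne'] at h2
    push_cast at h2
    linarith
end
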